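/- Let s ∈ 𝔛 with s_k > 0 for all k, and let R*_s be the Riesz measure with Laplace transform Δ_{−s} on 𝒫. Then for every m ∈ 𝒬 = M_{F(R*_s)}, the variance function of F(R*_s), as a linear operator 𝒵 → 𝒵, is given by V_{F(R*_s)}(m) = π ∘ { (n_1/s_1) ρ(m̂) + Σ_{i=2}^{r} (n_i/s_i − n_{i−1}/s_{i−1}) ρ( m̂ − [ ((m̂^{−1})_{{1:i−1}})^{−1} ]_0 ) }. -/

import Mathlib

open Matrix MeasureTheory Finset
open scoped ENNReal

namespace Wishart

instance {m n α : Type*} [MeasurableSpace α] : MeasurableSpace (Matrix m n α) :=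
  inferInstanceAs (MeasurableSpace (m → n → α))

/-- Index set of an `N × N` matrix partitioned into `r + 1` blocks of sizes `n 0, …, n r`. -/
abbrev Idx (r : ℕ) (n : Fin (r + 1) → ℕ+) := Σ k : Fin (r + 1), Fin (n k)

/-- Real matrices over the partitioned index set. -/
abbrev Mat (r : ℕ) (n : Fin (r + 1) → ℕ+) := Matrix (Idx r n) (Idx r n) ℝ

variable {r : ℕ} {n : Fin (r + 1) → ℕ+}

/-- The `(l,k)` block of a partitioned matrix. -/
def blk (x : Mat r n) (l k : Fin (r + 1)) : Matrix (Fin (n l)) (Fin (n k)) ℝ :=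
  Matrix.of fun a b => x ⟨l, a⟩ ⟨k, b⟩

variable (V : ∀ l k : Fin (r + 1), Submodule ℝ (Matrix (Fin (n l)) (Fin (n k)) ℝ))

/-- Condition (V1): `A ∈ 𝒱_{lk}`, `B ∈ 𝒱_{ki}` implies `A B ∈ 𝒱_{li}` for `i < k < l`. -/
def CondV1 : Prop := ∀ i k l : Fin (r + 1), i < k → k < l →
  ∀ A ∈ V l k, ∀ B ∈ V k i, A * B ∈ V l i

/-- Condition (V2): `A ∈ 𝒱_{li}`, `B ∈ 𝒱_{ki}` implies `A Bᵀ ∈ 𝒱_{lk}` for `i < k < l`. -/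
def CondV2 : Prop := ∀ i k l : Fin (r + 1), i < k → k < l →
  ∀ A ∈ V l i, ∀ B ∈ V k i, A * Bᵀ ∈ V l k

/-- Condition (V3): `A ∈ 𝒱_{lk}` implies `A Aᵀ ∈ ℝ I`. -/
def CondV3 : Prop := ∀ k l : Fin (r + 1), k < l →
  ∀ A ∈ V l k, ∃ c : ℝ, A * Aᵀ = c • (1 : Matrix (Fin (n l)) (Fin (n l)) ℝ)

/-- The space `𝒵` of symmetric matrices with lower blocks in `𝒱_{lk}` and scalar diagonal
blocks. -/
def Zspace : Set (Mat r n) :=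
  {x | x.IsSymm ∧ (∀ k l : Fin (r + 1), k < l → blk x l k ∈ V l k) ∧
    ∀ k : Fin (r + 1), ∃ c : ℝ, ∀ a b : Fin (n k),
      x ⟨k, a⟩ ⟨k, b⟩ = if a = b then c else 0}

/-- The trace inner product `⟨x, y⟩ = tr (x y)`. -/
def tip (x y : Mat r n) : ℝ := (x * y).trace

/-- The homogeneous cone `𝒫 = 𝒵 ∩ Sym₊(N, ℝ)`. -/
def Pcone : Set (Mat r n) := {x | x ∈ Zspace V ∧ x.PosDef}

/-- The dual cone `𝒬 = {ξ ∈ 𝒵 : ⟨ξ, x⟩ > 0 for all nonzero x in the closure of 𝒫}`. -/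
def Qcone : Set (Mat r n) :=
  {ξ | ξ ∈ Zspace V ∧ ∀ x ∈ closure (Pcone V), x ≠ 0 → 0 < tip ξ x}

/-- The group `H` of block lower triangular matrices with strictly lower blocks in `𝒱_{lk}`
and positive scalar diagonal blocks. -/
def Hgrp : Set (Mat r n) :=
  {T | (∀ k l : Fin (r + 1), l < k → blk T l k = 0) ∧
    (∀ k l : Fin (r + 1), k < l → blk T l k ∈ V l k) ∧
    ∀ k : Fin (r + 1), ∃ t : ℝ, 0 < t ∧ ∀ a b : Fin (n k),
      T ⟨k, a⟩ ⟨k, b⟩ = if a = b then t else 0}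

/-- `ρ(T) x = T x Tᵀ`. -/
def rhoM (T x : Mat r n) : Mat r n := T * x * Tᵀ

/-- The diagonal scalar `t_{kk}` of a matrix with scalar diagonal blocks. -/
def tdiag (T : Mat r n) (k : Fin (r + 1)) : ℝ :=
  T ⟨k, ⟨0, (n k).2⟩⟩ ⟨k, ⟨0, (n k).2⟩⟩

/-- The one-dimensional representation `χ_s(T) = ∏_k t_{kk}^{2 s_k}`. -/
noncomputable def chi (s : Fin (r + 1) → ℝ) (T : Mat r n) : ℝ :=
  ∏ k : Fin (r + 1), tdiag T k ^ (2 * s k)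

/-- `½ Σ_{i<k} ε_i dim 𝒱_{ki}`. -/
noncomputable def xiBound (ε : Fin (r + 1) → Bool) (k : Fin (r + 1)) : ℝ :=
  (1 / 2) * ∑ i ∈ Finset.univ.filter (fun i => i < k),
    (if ε i then (Module.finrank ℝ (V k i) : ℝ) else 0)

/-- The Gindikin set `Ξ`. -/
def XiSet : Set (Fin (r + 1) → ℝ) :=
  ⋃ ε : Fin (r + 1) → Bool,
    {s | ∀ k, (ε k = true → xiBound V ε k < s k) ∧ (ε k = false → s k = xiBound V ε k)}

/-- `½ Σ_{l>k} ε_l dim 𝒱_{lk}`. -/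
noncomputable def frakBound (ε : Fin (r + 1) → Bool) (k : Fin (r + 1)) : ℝ :=
  (1 / 2) * ∑ l ∈ Finset.univ.filter (fun l => k < l),
    (if ε l then (Module.finrank ℝ (V l k) : ℝ) else 0)

/-- The Gindikin set `𝔛`. -/
def frakX : Set (Fin (r + 1) → ℝ) :=
  ⋃ ε : Fin (r + 1) → Bool,
    {s | ∀ k, (ε k = true → frakBound V ε k < s k) ∧ (ε k = false → s k = frakBound V ε k)}

/-- Laplace transform `L_μ(θ) = ∫ e^{-⟨θ,x⟩} dμ(x)` (with values in `[0,∞]`). -/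
noncomputable def laplace (μ : Measure (Mat r n)) (θ : Mat r n) : ℝ≥0∞ :=
  ∫⁻ x, ENNReal.ofReal (Real.exp (-(tip θ x))) ∂μ

/-- Real-valued Laplace transform. -/
noncomputable def laplaceR (μ : Measure (Mat r n)) (θ : Mat r n) : ℝ :=
  ∫ x, Real.exp (-(tip θ x)) ∂μ

/-- Mean of the natural-exponential-family member `P(θ,μ)`, computed entrywise:
`m_μ(θ) = L_μ(θ)⁻¹ ∫ x e^{-⟨θ,x⟩} dμ(x)`. -/
noncomputable def meanMap (μ : Measure (Mat r n)) (θ : Mat r n) : Mat r n :=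
  Matrix.of fun p q => (laplaceR μ θ)⁻¹ * ∫ x, Real.exp (-(tip θ x)) * x p q ∂μ

/-- Covariance operator of `P(θ,μ)` with mean `m`, applied to `ξ ∈ 𝒵` (entrywise):
`V ξ = ∫ ⟨ξ, x - m⟩ (x - m) dP(θ,μ)(x)`. -/
noncomputable def varOp (μ : Measure (Mat r n)) (θ m ξ : Mat r n) : Mat r n :=
  Matrix.of fun p q =>
    (laplaceR μ θ)⁻¹ * ∫ x, Real.exp (-(tip θ x)) * tip ξ (x - m) * ((x - m) p q) ∂μ

/-- Leading principal submatrix `y_{{1:k}}` consisting of the blocks with indices `≤ k`. -/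
def lead (k : Fin (r + 1)) (y : Mat r n) :
    Matrix {p : Idx r n // p.1 ≤ k} {p : Idx r n // p.1 ≤ k} ℝ :=
  Matrix.of fun p q => y p.1 q.1

/-- Zero-padding `z₀` of a matrix `z` defined on the blocks with indices `≤ k`. -/
def pad (k : Fin (r + 1)) (z : Matrix {p : Idx r n // p.1 ≤ k} {p : Idx r n // p.1 ≤ k} ℝ) :
    Mat r n :=
  Matrix.of fun p q => if h : p.1 ≤ k ∧ q.1 ≤ k then z ⟨p, h.1⟩ ⟨q, h.2⟩ else 0

/-- `J_k = (I_{N_k})₀`. -/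
def Jmat (k : Fin (r + 1)) : Mat r n := pad k 1

/-- Parameters of elements of `W_i`: the scalar `x_{ii}` and the blocks `X_{li}`. -/
abbrev Wparam (r : ℕ) (n : Fin (r + 1) → ℕ+) (i : Fin (r + 1)) :=
  ℝ × ∀ l : Fin (r + 1), Matrix (Fin (n l)) (Fin (n i)) ℝ

/-- The `N × n_i` matrix in `W_i` with `i`-th block row `x_{ii} I` and `l`-th block row
`X_{li}` for `l > i`. -/
def toW (i : Fin (r + 1)) (p : Wparam r n i) : Matrix (Idx r n) (Fin (n i)) ℝ :=
  Matrix.of fun q b =>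
    if q.1 = i then (if (q.2 : ℕ) = (b : ℕ) then p.1 else 0)
    else if i < q.1 then p.2 q.1 q.2 b else 0

/-- A parameter tuple gives an honest element of `W_i`: blocks lie in `𝒱_{li}` and vanish
for `l ≤ i`. -/
def WGood (i : Fin (r + 1)) (p : Wparam r n i) : Prop :=
  (∀ l : Fin (r + 1), i < l → p.2 l ∈ V l i) ∧ (∀ l : Fin (r + 1), ¬ i < l → p.2 l = 0)

/-- The inner product `(A|B)` on `𝒱_{lk}`, characterized by `(ABᵀ + BAᵀ)/2 = (A|B) I`. -/
noncomputable def bip (l : Fin (r + 1)) {k : Fin (r + 1)}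
    (A B : Matrix (Fin (n l)) (Fin (n k)) ℝ) : ℝ :=
  (A * Bᵀ).trace / (n l : ℝ)

open scoped Classical in
/-- The generalized power function `Δ_s` on `𝒫`, defined by `Δ_s(ρ(T) I) = χ_s(T)`. -/
noncomputable def DeltaDef (s : Fin (r + 1) → ℝ) (x : Mat r n) : ℝ :=
  if h : ∃ T, T ∈ Hgrp V ∧ x = rhoM T 1 then chi s h.choose else 0

/-- Index set for the block diagonal matrix `Φ(ξ) = diag(φ_0(ξ), …, φ_r(ξ))`,
where `φ_i(ξ)` is of size `m_i = mdc i + 1`. -/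
abbrev DIdx (r : ℕ) (mdc : Fin (r + 1) → ℕ) := Σ i : Fin (r + 1), Fin (mdc i + 1)

/-- The block diagonal matrix `Φ(ξ) = diag(φ_0(ξ), …, φ_r(ξ))`. -/
def PhiMat {mdc : Fin (r + 1) → ℕ}
    (φ : ∀ i : Fin (r + 1), Mat r n → Matrix (Fin (mdc i + 1)) (Fin (mdc i + 1)) ℝ)
    (ξ : Mat r n) : Matrix (DIdx r mdc) (DIdx r mdc) ℝ :=
  Matrix.of fun p q =>
    if h : p.1 = q.1 then φ p.1 ξ p.2 (Fin.cast (by rw [h]) q.2) else 0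

/-- `Φ(I_N)^{-1/2}`: the inverse square root of the (diagonal, positive) matrix `Φ(I_N)`. -/
noncomputable def PhiISqrtInv {mdc : Fin (r + 1) → ℕ}
    (φ : ∀ i : Fin (r + 1), Mat r n → Matrix (Fin (mdc i + 1)) (Fin (mdc i + 1)) ℝ) :
    Matrix (DIdx r mdc) (DIdx r mdc) ℝ :=
  Matrix.diagonal fun p => (PhiMat φ (1 : Mat r n) p p) ^ (-(1 / 2) : ℝ)

/-! ### The algebra of block lower triangular matrices -/

lemma blk_apply (x : Mat r n) (l k : Fin (r + 1)) (a : Fin (n l)) (b : Fin (n k)) :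
    blk x l k a b = x ⟨l, a⟩ ⟨k, b⟩ := rfl

lemma blk_mul (x y : Mat r n) (l k : Fin (r + 1)) :
    blk (x * y) l k = ∑ i, blk x l i * blk y i k := by
  ext a b
  simp [Matrix.mul_apply, Fintype.sum_sigma, Matrix.sum_apply, blk_apply]

lemma blk_add (x y : Mat r n) (l k : Fin (r + 1)) :
    blk (x + y) l k = blk x l k + blk y l k := rfl

lemma blk_smul (c : ℝ) (x : Mat r n) (l k : Fin (r + 1)) :
    blk (c • x) l k = c • blk x l k := rfl

lemma blk_transpose (x : Mat r n) (l k : Fin (r + 1)) :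
    blk xᵀ l k = (blk x k l)ᵀ := rfl

lemma tdiag_add (x y : Mat r n) (k : Fin (r + 1)) :
    tdiag (x + y) k = tdiag x k + tdiag y k := rfl

lemma tdiag_smul (c : ℝ) (x : Mat r n) (k : Fin (r + 1)) :
    tdiag (c • x) k = c * tdiag x k := rfl

lemma tdiag_eq_of_blk {x : Mat r n} {k : Fin (r + 1)} {c : ℝ} (h : blk x k k = c • 1) :
    tdiag x k = c := by
  have := congrFun (congrFun h ⟨0, (n k).2⟩) ⟨0, (n k).2⟩
  simpa [blk_apply, tdiag] using this

lemma blk_eq_smul_one_iff {x : Mat r n} {k : Fin (r + 1)} {c : ℝ} :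
    (∀ a b : Fin (n k), x ⟨k, a⟩ ⟨k, b⟩ = if a = b then c else 0) ↔ blk x k k = c • 1 := by
  constructor
  · intro h
    ext a b
    simp [blk_apply, h, Matrix.one_apply]
  · intro h a b
    have := congrFun (congrFun h a) b
    simpa [blk_apply, Matrix.one_apply] using this

/-- The algebra of block lower triangular matrices with strictly lower blocks in `𝒱_{lk}` and
scalar diagonal blocks. -/
def lowTri : Submodule ℝ (Mat r n) where
  carrier := {T | (∀ k l, l < k → blk T l k = 0) ∧ (∀ k l, k < l → blk T l k ∈ V l k) ∧
    ∀ k, blk T k k = tdiag T k • 1}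
  add_mem' := by
    rintro x y ⟨hx1, hx2, hx3⟩ ⟨hy1, hy2, hy3⟩
    refine ⟨fun k l h => ?_, fun k l h => ?_, fun k => ?_⟩
    · rw [blk_add, hx1 k l h, hy1 k l h, add_zero]
    · exact (V l k).add_mem (hx2 k l h) (hy2 k l h)
    · rw [blk_add, tdiag_add, add_smul, ← hx3, ← hy3]
  zero_mem' := by
    refine ⟨fun k l h => rfl, fun k l h => (V l k).zero_mem, fun k => ?_⟩
    rw [tdiag, Matrix.zero_apply, zero_smul]
    rfl
  smul_mem' := by
    rintro c x ⟨hx1, hx2, hx3⟩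
    refine ⟨fun k l h => ?_, fun k l h => ?_, fun k => ?_⟩
    · rw [blk_smul, hx1 k l h, smul_zero]
    · exact (V l k).smul_mem c (hx2 k l h)
    · rw [blk_smul, tdiag_smul, mul_smul, ← hx3]

variable {V}

lemma mem_Hgrp_iff {T : Mat r n} : T ∈ Hgrp V ↔ T ∈ lowTri V ∧ ∀ k, 0 < tdiag T k := by
  constructor
  · rintro ⟨h1, h2, h3⟩
    choose t ht h using h3
    have e : ∀ k, tdiag T k = t k := fun k => tdiag_eq_of_blk (blk_eq_smul_one_iff.1 (h k))
    exact ⟨⟨h1, h2, fun k => by rw [e]; exact blk_eq_smul_one_iff.1 (h k)⟩,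
      fun k => by rw [e]; exact ht k⟩
  · rintro ⟨⟨h1, h2, h3⟩, h⟩
    exact ⟨h1, h2, fun k => ⟨_, h k, blk_eq_smul_one_iff.2 (h3 k)⟩⟩

/-- The block scalar matrix `diag (c_k I_{n_k})`. -/
def blockScalar (c : Fin (r + 1) → ℝ) : Mat r n := Matrix.diagonal fun p => c p.1

lemma tdiag_blockScalar (c : Fin (r + 1) → ℝ) (k : Fin (r + 1)) :
    tdiag (blockScalar c : Mat r n) k = c k := by
  simp [tdiag, blockScalar]

lemma blockScalar_mem_lowTri (c : Fin (r + 1) → ℝ) : blockScalar c ∈ lowTri V := by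
  have h : ∀ l k, l ≠ k → blk (blockScalar c : Mat r n) l k = 0 := by
    intro l k h
    ext a b
    rw [blk_apply, blockScalar, Matrix.diagonal_apply_ne _ (by
      intro h'; exact h (congrArg Sigma.fst h'))]
    rfl
  refine ⟨fun k l hlk => h _ _ hlk.ne, fun k l hlk => ?_, fun k => ?_⟩
  · rw [h _ _ hlk.ne']
    exact (V l k).zero_mem
  · rw [tdiag_blockScalar, ← blk_eq_smul_one_iff]
    intro a b
    simp [blockScalar, Matrix.diagonal_apply]

lemma blockScalar_one : (blockScalar (fun _ => 1) : Mat r n) = 1 := Matrix.diagonal_one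

lemma one_mem_lowTri : (1 : Mat r n) ∈ lowTri V := by
  rw [← blockScalar_one]
  exact blockScalar_mem_lowTri _

lemma tdiag_one (k : Fin (r + 1)) : tdiag (1 : Mat r n) k = 1 := by
  rw [← blockScalar_one, tdiag_blockScalar]

lemma blk_mul_diag {A B : Mat r n} (hA : A ∈ lowTri V) (hB : B ∈ lowTri V) (k : Fin (r + 1)) :
    blk (A * B) k k = (tdiag A k * tdiag B k) • 1 := by
  rw [blk_mul, Finset.sum_eq_single k]
  · rw [hA.2.2, hB.2.2, smul_mul_smul_comm, one_mul]
  · intro i _ hi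
    rcases lt_or_gt_of_ne hi with h | h
    · rw [hB.1 _ _ h, Matrix.mul_zero]
    · rw [hA.1 _ _ h, Matrix.zero_mul]
  · simp

lemma tdiag_mul {A B : Mat r n} (hA : A ∈ lowTri V) (hB : B ∈ lowTri V) (k : Fin (r + 1)) :
    tdiag (A * B) k = tdiag A k * tdiag B k :=
  tdiag_eq_of_blk (blk_mul_diag hA hB k)

lemma mul_mem_lowTri (hV1 : CondV1 V) {A B : Mat r n} (hA : A ∈ lowTri V) (hB : B ∈ lowTri V) :
    A * B ∈ lowTri V := by
  refine ⟨fun k l h => ?_, fun k l h => ?_, fun k => ?_⟩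
  · rw [blk_mul]
    refine Finset.sum_eq_zero fun i _ => ?_
    rcases lt_or_ge i k with hi | hi
    · rw [hB.1 _ _ hi, Matrix.mul_zero]
    · rw [hA.1 _ _ (h.trans_le hi), Matrix.zero_mul]
  · rw [blk_mul]
    refine (V l k).sum_mem fun i _ => ?_
    rcases lt_trichotomy i k with hi | rfl | hi
    · rw [hB.1 _ _ hi, Matrix.mul_zero]
      exact (V l k).zero_mem
    · rw [hB.2.2, Matrix.mul_smul, Matrix.mul_one]
      exact (V l i).smul_mem _ (hA.2.1 _ _ h)
    · rcases lt_trichotomy i l with hl | rfl | hl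
      · exact hV1 _ _ _ hi hl _ (hA.2.1 _ _ hl) _ (hB.2.1 _ _ hi)
      · rw [hA.2.2, Matrix.smul_mul, Matrix.one_mul]
        exact (V i k).smul_mem _ (hB.2.1 _ _ h)
      · rw [hA.1 _ _ hl, Matrix.zero_mul]
        exact (V l k).zero_mem
  · rw [tdiag_mul hA hB, blk_mul_diag hA hB]

lemma det_lowTri {T : Mat r n} (hT : T ∈ lowTri V) : T.det = ∏ k, tdiag T k ^ (n k : ℕ) := by
  have hB : Matrix.BlockTriangular Tᵀ (Sigma.fst : Idx r n → Fin (r + 1)) := by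
    rintro ⟨i, a⟩ ⟨j, b⟩ h
    exact congrFun (congrFun (hT.1 i j h) b) a
  rw [← Matrix.det_transpose, hB.det_fintype]
  refine Finset.prod_congr rfl fun k _ => ?_
  have : Matrix.toSquareBlock Tᵀ Sigma.fst k = tdiag T k • 1 := by
    ext ⟨⟨i, a⟩, hi⟩ ⟨⟨j, b⟩, hj⟩
    obtain rfl : i = k := hi
    obtain rfl : j = i := hj
    have := congrFun (congrFun (hT.2.2 j) b) a
    rw [blk_apply] at this
    simp [Matrix.toSquareBlock_def, this, Matrix.one_apply, eq_comm]
  rw [this, Matrix.det_smul, Matrix.det_one, mul_one]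
  congr 1
  rw [← Fintype.card_fin (n k)]
  refine Fintype.card_congr
    (Equiv.symm ⟨fun a => ⟨⟨k, a⟩, rfl⟩, fun p => p.2 ▸ p.1.2, fun a => rfl, ?_⟩)
  rintro ⟨⟨i, a⟩, hi⟩
  obtain rfl : i = k := hi
  rfl

lemma isUnit_det_of_mem_Hgrp {T : Mat r n} (hT : T ∈ Hgrp V) : IsUnit T.det := by
  rw [mem_Hgrp_iff] at hT
  rw [det_lowTri hT.1]
  exact (Finset.prod_pos fun k _ => pow_pos (hT.2 k) _).ne'.isUnit

lemma inv_mem_Hgrp (hV1 : CondV1 V) {T : Mat r n} (hT : T ∈ Hgrp V) : T⁻¹ ∈ Hgrp V := by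
  have hu := isUnit_det_of_mem_Hgrp hT
  rw [mem_Hgrp_iff] at hT
  let f : lowTri V →ₗ[ℝ] lowTri V := (LinearMap.mulLeft ℝ T).restrict
    fun x hx => mul_mem_lowTri hV1 hT.1 hx
  have hf : Function.Injective f := by
    rintro ⟨x, hx⟩ ⟨y, hy⟩ h
    have h' : T * x = T * y := congrArg Subtype.val h
    have h2 := congrArg (T⁻¹ * ·) h'
    simp only [Matrix.nonsing_inv_mul_cancel_left _ _ hu] at h2
    exact Subtype.ext h2
  obtain ⟨⟨S, hS⟩, h⟩ := LinearMap.injective_iff_surjective.1 hf ⟨1, one_mem_lowTri⟩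
  have hTS : T * S = 1 := congrArg Subtype.val h
  rw [Matrix.inv_eq_right_inv hTS]
  refine mem_Hgrp_iff.2 ⟨hS, fun k => ?_⟩
  have := tdiag_mul hT.1 hS k
  rw [hTS, tdiag_one] at this
  exact pos_of_mul_pos_right (this ▸ one_pos) (hT.2 k).le

lemma mul_mem_Hgrp (hV1 : CondV1 V) {S T : Mat r n} (hS : S ∈ Hgrp V) (hT : T ∈ Hgrp V) :
    S * T ∈ Hgrp V := by
  rw [mem_Hgrp_iff] at *
  refine ⟨mul_mem_lowTri hV1 hS.1 hT.1, fun k => ?_⟩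
  rw [tdiag_mul hS.1 hT.1]
  exact mul_pos (hS.2 k) (hT.2 k)

lemma blockScalar_mem_Hgrp {c : Fin (r + 1) → ℝ} (hc : ∀ k, 0 < c k) :
    (blockScalar c : Mat r n) ∈ Hgrp V :=
  mem_Hgrp_iff.2 ⟨blockScalar_mem_lowTri c, fun k => by rw [tdiag_blockScalar]; exact hc k⟩

/-! ### The space `𝒵` -/

lemma mem_Zspace_iff {x : Mat r n} : x ∈ Zspace V ↔ xᵀ = x ∧
    (∀ k l, k < l → blk x l k ∈ V l k) ∧ ∀ k, blk x k k = tdiag x k • 1 := by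
  constructor
  · rintro ⟨h1, h2, h3⟩
    refine ⟨h1, h2, fun k => ?_⟩
    obtain ⟨c, hc⟩ := h3 k
    rw [blk_eq_smul_one_iff] at hc
    rw [tdiag_eq_of_blk hc, hc]
  · rintro ⟨h1, h2, h3⟩
    exact ⟨h1, h2, fun k => ⟨_, blk_eq_smul_one_iff.2 (h3 k)⟩⟩

variable (V) in
/-- `𝒵` as a linear subspace. -/
def Zsub : Submodule ℝ (Mat r n) where
  carrier := Zspace V
  add_mem' := by
    intro x y hx hy
    rw [mem_Zspace_iff] at *
    refine ⟨by rw [Matrix.transpose_add, hx.1, hy.1],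
      fun k l h => (V l k).add_mem (hx.2.1 k l h) (hy.2.1 k l h), fun k => ?_⟩
    rw [blk_add, tdiag_add, add_smul, ← hx.2.2, ← hy.2.2]
  zero_mem' := by
    rw [mem_Zspace_iff]
    refine ⟨Matrix.transpose_zero, fun k l h => (V l k).zero_mem, fun k => ?_⟩
    rw [tdiag, Matrix.zero_apply, zero_smul]
    rfl
  smul_mem' := by
    intro c x hx
    rw [mem_Zspace_iff] at *
    refine ⟨by rw [Matrix.transpose_smul, hx.1],
      fun k l h => (V l k).smul_mem c (hx.2.1 k l h), fun k => ?_⟩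
    rw [blk_smul, tdiag_smul, mul_smul, ← hx.2.2]

lemma mul_transpose_self_mem (hV2 : CondV2 V) (hV3 : CondV3 V) {A : Mat r n}
    (hA : A ∈ lowTri V) : A * Aᵀ ∈ Zsub V := by
  refine ⟨by simp [Matrix.IsSymm], fun k l h => ?_, fun k => ?_⟩
  · rw [blk_mul]
    refine (V l k).sum_mem fun i _ => ?_
    rw [blk_transpose]
    rcases lt_trichotomy i k with hi | rfl | hi
    · exact hV2 _ _ _ hi h _ (hA.2.1 _ _ (hi.trans h)) _ (hA.2.1 _ _ hi)
    · rw [hA.2.2, Matrix.transpose_smul, Matrix.transpose_one, Matrix.mul_smul, Matrix.mul_one]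
      exact (V l i).smul_mem _ (hA.2.1 _ _ h)
    · rw [hA.1 _ _ hi, Matrix.transpose_zero, Matrix.mul_zero]
      exact (V l k).zero_mem
  · have h : ∀ i, ∃ c : ℝ, blk A k i * (blk A k i)ᵀ = c • 1 := by
      intro i
      rcases lt_trichotomy i k with hi | rfl | hi
      · exact hV3 _ _ hi _ (hA.2.1 _ _ hi)
      · refine ⟨tdiag A i * tdiag A i, ?_⟩
        rw [hA.2.2, Matrix.transpose_smul, Matrix.transpose_one, smul_mul_smul_comm, one_mul]
      · exact ⟨0, by rw [hA.1 _ _ hi, Matrix.zero_mul, zero_smul]⟩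
    choose c hc using h
    refine ⟨∑ i, c i, blk_eq_smul_one_iff.2 ?_⟩
    rw [blk_mul, Finset.sum_smul]
    exact Finset.sum_congr rfl fun i _ => by rw [blk_transpose, hc]

lemma mul_transpose_add_mem (hV2 : CondV2 V) (hV3 : CondV3 V) {A B : Mat r n}
    (hA : A ∈ lowTri V) (hB : B ∈ lowTri V) : A * Bᵀ + B * Aᵀ ∈ Zsub V := by
  have h := (Zsub V).sub_mem ((Zsub V).sub_mem
    (mul_transpose_self_mem hV2 hV3 ((lowTri V).add_mem hA hB))
    (mul_transpose_self_mem hV2 hV3 hA)) (mul_transpose_self_mem hV2 hV3 hB)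
  convert h using 1
  rw [Matrix.transpose_add]
  noncomm_ring

lemma exists_lowTri_add_transpose {x : Mat r n} (hx : x ∈ Zsub V) :
    ∃ A ∈ lowTri V, x = A + Aᵀ := by
  obtain ⟨h1, h2, h3⟩ := mem_Zspace_iff.1 hx
  refine ⟨Matrix.of fun p q => if q.1 < p.1 then x p q else if p.1 = q.1 then x p q / 2 else 0,
    ⟨fun k l h => ?_, fun k l h => ?_, fun k => ?_⟩, ?_⟩
  · ext a b
    simp [blk_apply, h.not_gt, h.ne]
  · convert h2 k l h using 1
    ext a b
    simp [blk_apply, h]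
  · ext a b
    have := congrFun (congrFun (h3 k) a) b
    simp only [blk_apply, Matrix.smul_apply] at this
    simp [blk_apply, tdiag, this]
    ring
  · ext p q
    have hs : x q p = x p q := congrFun (congrFun h1 p) q
    rcases lt_trichotomy p.1 q.1 with h | h | h
    · simp [h, h.not_gt, h.ne, hs]
    · simp [h, hs]
    · have h' : ¬ p.1 = q.1 := h.ne'
      simp [h, h.not_gt, Ne.symm h']

lemma rhoM_mem (hV1 : CondV1 V) (hV2 : CondV2 V) (hV3 : CondV3 V) {T x : Mat r n}
    (hT : T ∈ lowTri V) (hx : x ∈ Zsub V) : rhoM T x ∈ Zsub V := by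
  obtain ⟨A, hA, rfl⟩ := exists_lowTri_add_transpose hx
  convert mul_transpose_add_mem hV2 hV3 (mul_mem_lowTri hV1 hT hA) hT using 1
  rw [rhoM, Matrix.transpose_mul]
  noncomm_ring

/-! ### The Cholesky decomposition -/

variable (V) in
/-- The strictly lower triangular elements of `lowTri V`. -/
def strictLow : Submodule ℝ (Mat r n) where
  carrier := {T | T ∈ lowTri V ∧ ∀ k, tdiag T k = 0}
  add_mem' := by
    rintro x y ⟨hx, hx'⟩ ⟨hy, hy'⟩
    exact ⟨(lowTri V).add_mem hx hy, fun k => by rw [tdiag_add, hx', hy', add_zero]⟩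
  zero_mem' := ⟨(lowTri V).zero_mem, fun k => rfl⟩
  smul_mem' := by
    rintro c x ⟨hx, hx'⟩
    exact ⟨(lowTri V).smul_mem c hx, fun k => by rw [tdiag_smul, hx', mul_zero]⟩

lemma trace_mul_transpose (x y : Mat r n) : (x * yᵀ).trace = ∑ p, ∑ q, x p q * y p q := by
  simp [Matrix.trace, Matrix.mul_apply]

lemma eq_zero_of_trace_mul_mul_transpose {θ F : Mat r n} (hθ : θ.PosDef)
    (h : (F * θ * Fᵀ).trace = 0) : F = 0 := by
  have key : (F * θ * Fᵀ).trace = ∑ p, star (F p) ⬝ᵥ (θ *ᵥ F p) := by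
    rw [Matrix.trace]
    refine Finset.sum_congr rfl fun p _ => ?_
    rw [Matrix.dotProduct_mulVec, star_trivial]
    rfl
  have hnn : ∀ p ∈ Finset.univ, 0 ≤ star (F p) ⬝ᵥ (θ *ᵥ F p) :=
    fun p _ => hθ.posSemidef.dotProduct_mulVec_nonneg _
  rw [key, Finset.sum_eq_zero_iff_of_nonneg hnn] at h
  ext p q
  by_contra hne
  exact (hθ.dotProduct_mulVec_pos (x := F p) fun h0 => hne (congrFun h0 q)).ne'
    (h p (Finset.mem_univ p))

lemma posDef_rhoM {T x : Mat r n} (hT : IsUnit T.det) (hx : x.PosDef) : (rhoM T x).PosDef := by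
  have := hx.mul_mul_conjTranspose_same (B := T)
    (Matrix.vecMul_injective_of_isUnit ((Matrix.isUnit_iff_isUnit_det T).2 hT))
  rwa [Matrix.conjTranspose_eq_transpose_of_trivial] at this

lemma rhoM_rhoM (S T x : Mat r n) : rhoM S (rhoM T x) = rhoM (S * T) x := by
  simp only [rhoM, Matrix.transpose_mul, Matrix.mul_assoc]

lemma rhoM_one_left (x : Mat r n) : rhoM 1 x = x := by simp [rhoM]

lemma blockScalar_mul (c d : Fin (r + 1) → ℝ) :
    (blockScalar c * blockScalar d : Mat r n) = blockScalar fun k => c k * d k :=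
  Matrix.diagonal_mul_diagonal _ _

lemma blockScalar_transpose (c : Fin (r + 1) → ℝ) :
    (blockScalar c : Mat r n)ᵀ = blockScalar c := Matrix.diagonal_transpose _

lemma rhoM_blockScalar (c : Fin (r + 1) → ℝ) (x : Mat r n) :
    rhoM (blockScalar c) x = blockScalar c * x * blockScalar c := by
  rw [rhoM, blockScalar_transpose]

lemma rhoM_blockScalar_one (c : Fin (r + 1) → ℝ) :
    rhoM (blockScalar c) (1 : Mat r n) = blockScalar fun k => c k * c k := by
  rw [rhoM_blockScalar, Matrix.mul_one, blockScalar_mul]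

/-- The strictly lower block triangular part of a matrix. -/
def strictPart (x : Mat r n) : Mat r n := Matrix.of fun p q => if q.1 < p.1 then x p q else 0

lemma strictPart_mem {x : Mat r n} (hx : x ∈ Zsub V) : strictPart x ∈ strictLow V := by
  obtain ⟨h1, h2, h3⟩ := mem_Zspace_iff.1 hx
  have h0 : ∀ k, tdiag (strictPart x) k = 0 := fun k => by simp [tdiag, strictPart]
  refine ⟨⟨fun k l h => ?_, fun k l h => ?_, fun k => ?_⟩, h0⟩
  · ext a b
    simp [blk_apply, strictPart, h.not_gt]
  · convert h2 k l h using 1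
    ext a b
    simp [blk_apply, strictPart, h]
  · rw [h0]
    ext a b
    simp [blk_apply, strictPart]

lemma eq_blockScalar_of_strictPart_eq_zero {x : Mat r n} (hx : x ∈ Zsub V)
    (h : strictPart x = 0) : x = blockScalar (tdiag x) := by
  obtain ⟨h1, h2, h3⟩ := mem_Zspace_iff.1 hx
  have h0 : ∀ p q : Idx r n, q.1 < p.1 → x p q = 0 := fun p q hpq => by
    have := congrFun (congrFun h p) q
    simpa [strictPart, hpq] using this
  ext ⟨l, a⟩ ⟨k, b⟩
  rcases lt_trichotomy l k with hlk | rfl | hlk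
  · rw [← h1, Matrix.transpose_apply, h0 _ _ hlk, blockScalar, Matrix.diagonal_apply_ne]
    exact fun h' => hlk.ne (congrArg Sigma.fst h')
  · rw [blk_eq_smul_one_iff.2 (h3 l)]
    simp [blockScalar, Matrix.diagonal_apply]
  · rw [h0 _ _ hlk, blockScalar, Matrix.diagonal_apply_ne]
    exact fun h' => hlk.ne' (congrArg Sigma.fst h')

/-- The bilinear form `(F, G) ↦ tr (F θ Gᵀ)`. -/
def traceForm (θ : Mat r n) : Mat r n →ₗ[ℝ] Mat r n →ₗ[ℝ] ℝ :=
  LinearMap.mk₂ ℝ (fun F G => (F * θ * Gᵀ).trace)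
    (fun F F' G => by simp only [Matrix.add_mul, Matrix.trace_add])
    (fun c F G => by simp only [Matrix.smul_mul, Matrix.trace_smul])
    (fun F G G' => by simp only [Matrix.transpose_add, Matrix.mul_add, Matrix.trace_add])
    (fun c F G => by simp only [Matrix.transpose_smul, Matrix.mul_smul, Matrix.trace_smul])

lemma exists_strictLow_solution {θ : Mat r n} (hθ : θ.PosDef) :
    ∃ F ∈ strictLow V, ∀ G ∈ strictLow V, (F * θ * Gᵀ).trace = -(θ * Gᵀ).trace := by
  let f : strictLow V →ₗ[ℝ] Module.Dual ℝ (strictLow V) :=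
    ((traceForm θ).domRestrict₁₂ (strictLow V) (strictLow V))
  have hf : Function.Injective f := by
    rw [← LinearMap.ker_eq_bot, LinearMap.ker_eq_bot']
    rintro ⟨F, hF⟩ h
    exact Subtype.ext (eq_zero_of_trace_mul_mul_transpose hθ
      (LinearMap.congr_fun h ⟨F, hF⟩))
  have hs := (LinearMap.injective_iff_surjective_of_finrank_eq_finrank
    (Subspace.dual_finrank_eq (K := ℝ) (V := strictLow V)).symm).1 hf
  obtain ⟨⟨F, hF⟩, h⟩ := hs (-((traceForm θ 1).domRestrict (strictLow V)))
  refine ⟨F, hF, fun G hG => ?_⟩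
  have := LinearMap.congr_fun h ⟨G, hG⟩
  change (F * θ * Gᵀ).trace = -(1 * θ * Gᵀ).trace at this
  rwa [Matrix.one_mul] at this

theorem exists_cholesky (hV1 : CondV1 V) (hV2 : CondV2 V) (hV3 : CondV3 V) {θ : Mat r n}
    (hθ : θ ∈ Pcone V) : ∃ T ∈ Hgrp V, θ = rhoM T 1 := by
  obtain ⟨hθZ, hθ⟩ := hθ
  obtain ⟨F, hF, hFG⟩ := exists_strictLow_solution (V := V) hθ
  have hE : 1 + F ∈ Hgrp V := mem_Hgrp_iff.2 ⟨(lowTri V).add_mem one_mem_lowTri hF.1, fun k => by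
    rw [tdiag_add, hF.2, add_zero, tdiag_one]; exact one_pos⟩
  have hEu := isUnit_det_of_mem_Hgrp hE
  set E := 1 + F with hEdef
  set x := rhoM E θ with hx
  have hxZ : x ∈ Zsub V := rhoM_mem hV1 hV2 hV3 (mem_Hgrp_iff.1 hE).1 hθZ
  have hxP : x.PosDef := posDef_rhoM hEu hθ
  have horth : ∀ G ∈ strictLow V, (x * Gᵀ).trace = 0 := by
    intro G hG
    have hGE : G * E ∈ strictLow V := ⟨mul_mem_lowTri hV1 hG.1 (mem_Hgrp_iff.1 hE).1, fun k => by
      rw [tdiag_mul hG.1 (mem_Hgrp_iff.1 hE).1, hG.2, zero_mul]⟩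
    have e : x * Gᵀ = θ * (G * E)ᵀ + F * θ * (G * E)ᵀ := by
      rw [hx, rhoM, Matrix.transpose_mul]
      conv_lhs => rw [Matrix.mul_assoc, hEdef]
      rw [Matrix.add_mul, Matrix.add_mul, Matrix.one_mul]
    rw [e, Matrix.trace_add, hFG _ hGE, add_neg_cancel]
  have hzero : strictPart x = 0 := by
    have h := horth _ (strictPart_mem hxZ)
    have h' : (x * (strictPart x)ᵀ).trace = ∑ p, ∑ q, strictPart x p q ^ 2 := by
      rw [trace_mul_transpose]
      refine Finset.sum_congr rfl fun p _ => Finset.sum_congr rfl fun q _ => ?_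
      simp only [strictPart, Matrix.of_apply]
      split_ifs <;> ring
    have h2 := (Finset.sum_eq_zero_iff_of_nonneg
      (fun p _ => Finset.sum_nonneg fun q _ => sq_nonneg _)).1 (h'.symm.trans h)
    ext p q
    have := (Finset.sum_eq_zero_iff_of_nonneg (fun q _ => sq_nonneg _)).1
      (h2 p (Finset.mem_univ p)) q (Finset.mem_univ q)
    exact pow_eq_zero_iff (two_ne_zero) |>.1 this
  have hxd := eq_blockScalar_of_strictPart_eq_zero hxZ hzero
  have hpos : ∀ k, 0 < tdiag x k := fun k => hxP.diag_pos
  refine ⟨E⁻¹ * blockScalar fun k => √(tdiag x k), mul_mem_Hgrp hV1 (inv_mem_Hgrp hV1 hE)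
    (blockScalar_mem_Hgrp fun k => Real.sqrt_pos.2 (hpos k)), ?_⟩
  rw [← rhoM_rhoM, rhoM_blockScalar_one]
  simp only [Real.mul_self_sqrt (hpos _).le]
  rw [← hxd, hx, rhoM_rhoM, Matrix.nonsing_inv_mul _ hEu, rhoM_one_left]

lemma rhoM_one_mem_Pcone (hV2 : CondV2 V) (hV3 : CondV3 V) {T : Mat r n} (hT : T ∈ Hgrp V) :
    rhoM T 1 ∈ Pcone V := by
  refine ⟨?_, posDef_rhoM (isUnit_det_of_mem_Hgrp hT) Matrix.PosDef.one⟩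
  rw [rhoM, Matrix.mul_one]
  exact mul_transpose_self_mem hV2 hV3 (mem_Hgrp_iff.1 hT).1

/-! ### Second order expansions at the origin -/

/-- `g` is twice differentiable at `0` with first and second derivatives `a` and `b`. -/
def HasJet (g : ℝ → ℝ) (a b : ℝ) : Prop :=
  ∃ g' : ℝ → ℝ, (∀ᶠ t in nhds 0, HasDerivAt g (g' t) t) ∧ g' 0 = a ∧ HasDerivAt g' b 0

lemma HasJet.const_mul {g : ℝ → ℝ} {a b : ℝ} (h : HasJet g a b) (c : ℝ) :
    HasJet (fun t => c * g t) (c * a) (c * b) := by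
  obtain ⟨g', h1, h2, h3⟩ := h
  exact ⟨fun t => c * g' t, h1.mono fun t ht => ht.const_mul c, by simp [h2], h3.const_mul c⟩

lemma HasJet.sub {f g : ℝ → ℝ} {a b c d : ℝ} (hf : HasJet f a b) (hg : HasJet g c d) :
    HasJet (fun t => f t - g t) (a - c) (b - d) := by
  obtain ⟨f', h1, h2, h3⟩ := hf
  obtain ⟨g', k1, k2, k3⟩ := hg
  refine ⟨fun t => f' t - g' t, ?_, by simp [h2, k2], h3.sub k3⟩
  filter_upwards [h1, k1] with t ht kt using ht.sub kt

lemma HasJet.sum {ι : Type*} [Fintype ι] {g : ι → ℝ → ℝ} {a b : ι → ℝ}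
    (h : ∀ i, HasJet (g i) (a i) (b i)) :
    HasJet (fun t => ∑ i, g i t) (∑ i, a i) (∑ i, b i) := by
  choose g' h1 h2 h3 using h
  refine ⟨fun t => ∑ i, g' i t, ?_, by simp [h2], HasDerivAt.fun_sum fun i _ => h3 i⟩
  filter_upwards [Filter.eventually_all.2 h1] with t ht
  exact HasDerivAt.fun_sum fun i _ => ht i

lemma HasJet.congr {f g : ℝ → ℝ} {a b : ℝ} (h : HasJet f a b) (hfg : g =ᶠ[nhds 0] f) :
    HasJet g a b := by
  obtain ⟨f', h1, h2, h3⟩ := h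
  refine ⟨f', ?_, h2, h3⟩
  filter_upwards [h1, hfg.eventuallyEq_nhds] with t ht ht' using ht.congr_of_eventuallyEq ht'

lemma HasJet.deriv_eq {g : ℝ → ℝ} {a b : ℝ} (h : HasJet g a b) : deriv g 0 = a := by
  obtain ⟨g', h1, h2, h3⟩ := h
  rw [h1.self_of_nhds.deriv, h2]

lemma HasJet.iteratedDeriv_two_eq {g : ℝ → ℝ} {a b : ℝ} (h : HasJet g a b) :
    iteratedDeriv 2 g 0 = b := by
  obtain ⟨g', h1, h2, h3⟩ := h
  rw [iteratedDeriv_succ, iteratedDeriv_one]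
  have : deriv g =ᶠ[nhds 0] g' := by filter_upwards [h1] with t ht using ht.deriv
  rw [this.deriv_eq, h3.deriv]

lemma eventually_one_add_mul_pos (c : ℝ) : ∀ᶠ t : ℝ in nhds 0, 0 < 1 + t * c := by
  have h : ContinuousAt (fun t : ℝ => 1 + t * c) 0 := by fun_prop
  exact h.eventually (lt_mem_nhds (by simp))

lemma hasJet_log_one_add_mul (c : ℝ) :
    HasJet (fun t => Real.log (1 + t * c)) c (-c ^ 2) := by
  have hlin : ∀ t : ℝ, HasDerivAt (fun t : ℝ => 1 + t * c) c t := fun t => by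
    simpa using ((hasDerivAt_id t).mul_const c).const_add 1
  refine ⟨fun t => c / (1 + t * c), ?_, by simp, ?_⟩
  · filter_upwards [eventually_one_add_mul_pos c] with t ht
    exact (hlin t).log ht.ne'
  · have := (hasDerivAt_const (0 : ℝ) c).div (hlin 0) (by simp)
    exact this.congr_deriv (by simp; ring)

lemma exists_eigenvalues {ι : Type*} [Fintype ι] [DecidableEq ι] {B : Matrix ι ι ℝ}
    (hB : Bᵀ = B) : ∃ c : ι → ℝ, (∀ t : ℝ, (1 + t • B).det = ∏ i, (1 + t * c i)) ∧
      B.trace = ∑ i, c i ∧ (B * B).trace = ∑ i, c i ^ 2 ∧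
      ∀ t : ℝ, (∀ i, 0 < 1 + t * c i) → (1 + t • B).PosDef := by
  have hH : B.IsHermitian := by
    rw [Matrix.IsHermitian, Matrix.conjTranspose_eq_transpose_of_trivial, hB]
  set c := hH.eigenvalues
  set U : Matrix ι ι ℝ := hH.eigenvectorUnitary.1
  have hUU : U * star U = 1 := Unitary.coe_mul_star_self _
  have hUU' : star U * U = 1 := Unitary.coe_star_mul_self _
  have hspec : B = U * Matrix.diagonal c * star U := by
    have := hH.spectral_theorem
    rw [Unitary.conjStarAlgAut_apply] at this
    exact this
  have ht : ∀ t : ℝ, 1 + t • B = U * Matrix.diagonal (fun i => 1 + t * c i) * star U := by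
    intro t
    have : Matrix.diagonal (fun i => 1 + t * c i) = 1 + t • Matrix.diagonal c := by
      ext i j
      by_cases h : i = j <;> simp [h]
    rw [this, Matrix.mul_add, Matrix.add_mul, Matrix.mul_one, hUU, Matrix.mul_smul,
      Matrix.smul_mul, ← hspec]
  have htr : ∀ M : Matrix ι ι ℝ, (U * M * star U).trace = M.trace := fun M => by
    rw [Matrix.trace_mul_comm, ← Matrix.mul_assoc, hUU', Matrix.one_mul]
  refine ⟨c, fun t => ?_, ?_, ?_, fun t h => ?_⟩
  · rw [ht, Matrix.det_mul, Matrix.det_mul, mul_right_comm, ← Matrix.det_mul, hUU, Matrix.det_one,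
      one_mul, Matrix.det_diagonal]
  · rw [hspec, htr, Matrix.trace_diagonal]
  · have : B * B = U * Matrix.diagonal (fun i => c i ^ 2) * star U := by
      nth_rw 1 [hspec]
      nth_rw 1 [hspec]
      calc U * Matrix.diagonal c * star U * (U * Matrix.diagonal c * star U)
          = U * Matrix.diagonal c * (star U * U) * Matrix.diagonal c * star U := by
            simp only [Matrix.mul_assoc]
        _ = _ := by
            rw [hUU', Matrix.mul_one, Matrix.mul_assoc U, Matrix.diagonal_mul_diagonal]
            simp only [sq]
    rw [this, htr, Matrix.trace_diagonal]
  · rw [ht]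
    refine (Matrix.PosDef.diagonal h).mul_mul_conjTranspose_same ?_
    exact Matrix.vecMul_injective_of_isUnit ⟨⟨U, star U, hUU, hUU'⟩, rfl⟩

lemma hasJet_log_det {ι : Type*} [Fintype ι] [DecidableEq ι] {B : Matrix ι ι ℝ}
    (hB : Bᵀ = B) :
    HasJet (fun t => Real.log (1 + t • B).det) B.trace (-(B * B).trace) := by
  obtain ⟨c, h1, h2, h3, -⟩ := exists_eigenvalues hB
  rw [h2, h3, ← Finset.sum_neg_distrib]
  refine (HasJet.sum fun i => hasJet_log_one_add_mul (c i)).congr ?_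
  filter_upwards [Filter.eventually_all.2 fun i => eventually_one_add_mul_pos (c i)] with t ht
  rw [h1, Real.log_prod fun i _ => (ht i).ne']

lemma eventually_posDef {ι : Type*} [Fintype ι] [DecidableEq ι] {B : Matrix ι ι ℝ}
    (hB : Bᵀ = B) : ∀ᶠ t : ℝ in nhds 0, (1 + t • B).PosDef := by
  obtain ⟨c, -, -, -, h⟩ := exists_eigenvalues hB
  filter_upwards [Filter.eventually_all.2 fun i => eventually_one_add_mul_pos (c i)] with t ht
  exact h t ht

/-! ### The character `χ_s` near the identity -/

lemma blockScalar_mul_mul_apply (c d : Fin (r + 1) → ℝ) (x : Mat r n) (p q : Idx r n) :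
    (blockScalar c * x * blockScalar d : Mat r n) p q = c p.1 * x p q * d q.1 := by
  rw [blockScalar, blockScalar, Matrix.mul_diagonal, Matrix.diagonal_mul]

/-- The block scalar projection onto the blocks satisfying `P`. -/
def blockProj (P : Fin (r + 1) → Prop) [DecidablePred P] : Mat r n :=
  blockScalar fun i => if P i then 1 else 0

lemma blockProj_transpose (P : Fin (r + 1) → Prop) [DecidablePred P] :
    (blockProj P : Mat r n)ᵀ = blockProj P := blockScalar_transpose _

lemma blockProj_mul_self (P : Fin (r + 1) → Prop) [DecidablePred P] :
    (blockProj P * blockProj P : Mat r n) = blockProj P := by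
  rw [blockProj, blockScalar_mul]
  congr 1
  ext k
  split_ifs <;> simp

lemma blockProj_mul_lowTri {P : Fin (r + 1) → Prop} [DecidablePred P]
    (hP : ∀ i j, i ≤ j → P j → P i) {S : Mat r n} (hS : S ∈ lowTri V) :
    blockProj P * S * blockProj P = blockProj P * S := by
  ext p q
  rw [blockProj, blockScalar_mul_mul_apply, blockScalar, Matrix.diagonal_mul]
  rcases lt_or_ge p.1 q.1 with h | h
  · have : S p q = 0 := congrFun (congrFun (hS.1 q.1 p.1 h) p.2) q.2
    rw [this]
    ring
  · by_cases hp : P p.1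
    · simp [hp, hP _ _ h hp]
    · simp [hp]

lemma corner_eq {P : Fin (r + 1) → Prop} [DecidablePred P]
    (hP : ∀ i j, i ≤ j → P j → P i) {S B : Mat r n} (hS : S ∈ lowTri V) {t : ℝ}
    (h : 1 + t • B = S * Sᵀ) :
    1 + t • (blockProj P * B * blockProj P) =
      (1 - blockProj P + blockProj P * S * blockProj P) *
        (1 - blockProj P + blockProj P * S * blockProj P)ᵀ := by
  set J : Mat r n := blockProj P with hJ
  have hJJ : J * J = J := blockProj_mul_self P
  have hJt : Jᵀ = J := blockProj_transpose P
  have hJS : J * S * J = J * S := blockProj_mul_lowTri hP hS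
  have e1 : t • (J * B * J) = J * (t • B) * J := by simp
  have e2 : t • B = S * Sᵀ - 1 := by rw [← h]; abel
  have e3 : (1 - J + J * S * J)ᵀ = 1 - J + J * Sᵀ * J := by
    simp only [Matrix.transpose_add, Matrix.transpose_sub, Matrix.transpose_one,
      Matrix.transpose_mul, hJt, Matrix.mul_assoc]
  have e4 : (1 - J) * J = 0 := by rw [Matrix.sub_mul, hJJ, Matrix.one_mul, sub_self]
  have e5 : J * (1 - J) = 0 := by rw [Matrix.mul_sub, hJJ, Matrix.mul_one, sub_self]
  have e6 : (1 - J) * (1 - J) = 1 - J := by rw [Matrix.sub_mul, e5, Matrix.one_mul, sub_zero]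
  have e7 : (1 - J) * (J * Sᵀ * J) = 0 := by
    rw [Matrix.mul_assoc, ← Matrix.mul_assoc, e4, Matrix.zero_mul]
  have e8 : J * S * J * (1 - J) = 0 := by rw [Matrix.mul_assoc, e5, Matrix.mul_zero]
  have e9 : J * S * J * (J * Sᵀ * J) = J * (S * Sᵀ) * J := by
    calc J * S * J * (J * Sᵀ * J) = J * S * (J * J) * Sᵀ * J := by simp only [Matrix.mul_assoc]
      _ = J * S * J * Sᵀ * J := by rw [hJJ]
      _ = _ := by rw [hJS]; simp only [Matrix.mul_assoc]
  rw [e1, e2, e3, Matrix.add_mul, Matrix.mul_add, Matrix.mul_add, e6, e7, e8, e9, Matrix.mul_sub,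
    Matrix.sub_mul, Matrix.mul_one, hJJ]
  abel

lemma log_det_corner (hV1 : CondV1 V) {P : Fin (r + 1) → Prop} [DecidablePred P]
    (hP : ∀ i j, i ≤ j → P j → P i) {S B : Mat r n} (hS : S ∈ Hgrp V) {t : ℝ}
    (h : 1 + t • B = S * Sᵀ) :
    Real.log (1 + t • (blockProj P * B * blockProj P)).det =
      ∑ i, if P i then 2 * (n i : ℕ) * Real.log (tdiag S i) else 0 := by
  obtain ⟨hS, hpos⟩ := mem_Hgrp_iff.1 hS
  have hJ : (blockProj P : Mat r n) ∈ lowTri V := blockScalar_mem_lowTri _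
  have hJS := mul_mem_lowTri hV1 (mul_mem_lowTri hV1 hJ hS) hJ
  have hL : 1 - blockProj P + blockProj P * S * blockProj P ∈ lowTri V :=
    (lowTri V).add_mem ((lowTri V).sub_mem one_mem_lowTri hJ) hJS
  have hd : ∀ i, tdiag (1 - blockProj P + blockProj P * S * blockProj P) i =
      if P i then tdiag S i else 1 := by
    intro i
    have e : ∀ x y : Mat r n, tdiag (x - y) i = tdiag x i - tdiag y i := fun _ _ => rfl
    rw [tdiag_add, e, tdiag_one, tdiag_mul (mul_mem_lowTri hV1 hJ hS) hJ, tdiag_mul hJ hS,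
      blockProj, tdiag_blockScalar]
    split_ifs <;> simp
  rw [corner_eq hP hS h, Matrix.det_mul, Matrix.det_transpose, det_lowTri hL,
    ← Finset.prod_mul_distrib, Real.log_prod]
  · refine Finset.sum_congr rfl fun i _ => ?_
    rw [hd, ← mul_pow, Real.log_pow]
    split_ifs
    · rw [Real.log_mul (hpos i).ne' (hpos i).ne']
      ring
    · simp
  · intro i _
    rw [hd]
    split_ifs
    · exact mul_ne_zero (pow_ne_zero _ (hpos i).ne') (pow_ne_zero _ (hpos i).ne')
    · simp

/-- The logarithm of `Δ_{-s}(1 + tB)`, in terms of principal minors. -/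
noncomputable def logDelta (s : Fin (r + 1) → ℝ) (B : Mat r n) (t : ℝ) : ℝ :=
  ∑ k, -(s k / (n k : ℕ)) *
    (Real.log (1 + t • (blockProj (· ≤ k) * B * blockProj (· ≤ k))).det -
      Real.log (1 + t • (blockProj (· < k) * B * blockProj (· < k))).det)

lemma log_chi_eq (hV1 : CondV1 V) (s : Fin (r + 1) → ℝ) {S B : Mat r n} (hS : S ∈ Hgrp V) {t : ℝ}
    (h : 1 + t • B = S * Sᵀ) : Real.log (chi (-s) S) = logDelta s B t := by
  have hpos := (mem_Hgrp_iff.1 hS).2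
  rw [chi, Real.log_prod fun i _ => (Real.rpow_pos_of_pos (hpos i) _).ne', logDelta]
  refine Finset.sum_congr rfl fun k _ => ?_
  rw [log_det_corner hV1 (fun i j hij hj => hij.trans hj) hS h,
    log_det_corner hV1 (fun i j hij hj => hij.trans_lt hj) hS h, ← Finset.sum_sub_distrib,
    Finset.sum_eq_single k, Real.log_rpow (hpos k)]
  · have : ((n k : ℕ) : ℝ) ≠ 0 := Nat.cast_ne_zero.2 (n k).ne_zero
    simp
    field_simp
  · intro i _ hi
    have : i ≤ k ↔ i < k := ⟨fun h => lt_of_le_of_ne h hi, le_of_lt⟩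
    simp [this]
  · simp

lemma trace_corner (P : Fin (r + 1) → Prop) [DecidablePred P] (B : Mat r n) :
    (blockProj P * B * blockProj P : Mat r n).trace =
      ∑ p : Idx r n, if P p.1 then B p p else 0 := by
  refine Finset.sum_congr rfl fun p _ => ?_
  rw [Matrix.diag_apply, blockProj, blockScalar_mul_mul_apply]
  split_ifs <;> simp

lemma trace_corner_sq (P : Fin (r + 1) → Prop) [DecidablePred P] {B : Mat r n} (hB : Bᵀ = B) :
    (blockProj P * B * blockProj P * (blockProj P * B * blockProj P) : Mat r n).trace =
      ∑ p : Idx r n, ∑ q : Idx r n, if P p.1 ∧ P q.1 then B p q ^ 2 else 0 := by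
  have hs : (blockProj P * B * blockProj P : Mat r n) = (blockProj P * B * blockProj P)ᵀ := by
    rw [Matrix.transpose_mul, Matrix.transpose_mul, blockProj_transpose, hB, Matrix.mul_assoc]
  nth_rw 2 [hs]
  rw [trace_mul_transpose]
  refine Finset.sum_congr rfl fun p _ => Finset.sum_congr rfl fun q _ => ?_
  rw [blockProj, blockScalar_mul_mul_apply]
  by_cases hp : P p.1 <;> by_cases hq : P q.1 <;> simp [hp, hq, sq]

lemma hasJet_logDelta (s : Fin (r + 1) → ℝ) {B : Mat r n} (hB : Bᵀ = B) :
    HasJet (logDelta s B) (-∑ p : Idx r n, s p.1 / (n p.1 : ℕ) * B p p)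
      (∑ p : Idx r n, ∑ q : Idx r n, s (max p.1 q.1) / (n (max p.1 q.1) : ℕ) * B p q ^ 2) := by
  have hs : ∀ (P : Fin (r + 1) → Prop) [DecidablePred P],
      (blockProj P * B * blockProj P : Mat r n)ᵀ = blockProj P * B * blockProj P := by
    intro P _
    rw [Matrix.transpose_mul, Matrix.transpose_mul, blockProj_transpose, hB, Matrix.mul_assoc]
  have h := HasJet.sum fun k => ((hasJet_log_det (hs (· ≤ k))).sub
    (hasJet_log_det (hs (· < k)))).const_mul (-(s k / (n k : ℕ)))
  convert h using 1
  · rfl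
  · have e : ∀ k, -(s k / (n k : ℕ)) * ((blockProj (· ≤ k) * B * blockProj (· ≤ k) : Mat r n).trace
        - (blockProj (· < k) * B * blockProj (· < k) : Mat r n).trace) =
        ∑ p : Idx r n, -(s k / (n k : ℕ)) *
          ((if p.1 ≤ k then B p p else 0) - if p.1 < k then B p p else 0) := fun k => by
      rw [trace_corner, trace_corner, ← Finset.sum_sub_distrib, Finset.mul_sum]
    rw [Finset.sum_congr rfl fun k _ => e k, Finset.sum_comm, ← Finset.sum_neg_distrib]
    refine Finset.sum_congr rfl fun p _ => ?_
    rw [Finset.sum_eq_single p.1]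
    · simp
    · intro k _ hk
      have : p.1 ≤ k ↔ p.1 < k := ⟨fun h => lt_of_le_of_ne h hk.symm, le_of_lt⟩
      simp [this]
    · simp
  · have e : ∀ k, -(s k / (n k : ℕ)) * (-(blockProj (· ≤ k) * B * blockProj (· ≤ k) *
        (blockProj (· ≤ k) * B * blockProj (· ≤ k)) : Mat r n).trace -
        -(blockProj (· < k) * B * blockProj (· < k) *
        (blockProj (· < k) * B * blockProj (· < k)) : Mat r n).trace) =
        ∑ p : Idx r n, ∑ q : Idx r n, s k / (n k : ℕ) *
          ((if p.1 ≤ k ∧ q.1 ≤ k then B p q ^ 2 else 0) -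
            if p.1 < k ∧ q.1 < k then B p q ^ 2 else 0) := fun k => by
      rw [trace_corner_sq _ hB, trace_corner_sq _ hB]
      simp only [← Finset.mul_sum, Finset.sum_sub_distrib]
      ring
    symm
    rw [Finset.sum_congr rfl fun k _ => e k, Finset.sum_comm]
    refine Finset.sum_congr rfl fun p _ => ?_
    rw [Finset.sum_comm]
    refine Finset.sum_congr rfl fun q _ => ?_
    rw [Finset.sum_eq_single (max p.1 q.1)]
    · rw [if_pos ⟨le_max_left _ _, le_max_right _ _⟩,
        if_neg (by rw [← max_lt_iff]; exact lt_irrefl _), sub_zero]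
    · intro k _ hk
      have : (p.1 ≤ k ∧ q.1 ≤ k) ↔ (p.1 < k ∧ q.1 < k) := by
        rw [← max_le_iff, ← max_lt_iff]
        exact ⟨fun h => lt_of_le_of_ne h hk.symm, le_of_lt⟩
      simp [this]
    · simp

/-! ### Moments of the exponential family -/

lemma tip_eq_sum (x y : Mat r n) : tip x y = ∑ p, ∑ q, x p q * y q p := by
  simp [tip, Matrix.trace, Matrix.mul_apply]

lemma tip_comm (x y : Mat r n) : tip x y = tip y x := Matrix.trace_mul_comm x y

lemma tip_add_left (x y z : Mat r n) : tip (x + y) z = tip x z + tip y z := by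
  simp only [tip, Matrix.add_mul, Matrix.trace_add]

lemma tip_smul_left (c : ℝ) (x z : Mat r n) : tip (c • x) z = c * tip x z := by
  simp only [tip, Matrix.smul_mul, Matrix.trace_smul, smul_eq_mul]

lemma tip_sum_left {ι : Type*} (t : Finset ι) (f : ι → Mat r n) (z : Mat r n) :
    tip (∑ i ∈ t, f i) z = ∑ i ∈ t, tip (f i) z := by
  simp only [tip, Matrix.sum_mul, Matrix.trace_sum]

lemma tip_sub_right (x y z : Mat r n) : tip x (y - z) = tip x y - tip x z := by
  simp only [tip, Matrix.mul_sub, Matrix.trace_sub]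

lemma tip_single_left (p q : Idx r n) (x : Mat r n) :
    tip (Matrix.single q p 1) x = x p q := by
  rw [tip_comm, tip, Matrix.trace_mul_single]
  simp

lemma measurable_apply (p q : Idx r n) : Measurable (fun x : Mat r n => x p q) :=
  (measurable_pi_apply (X := fun _ : Idx r n => ℝ) q).comp
    (measurable_pi_apply (X := fun _ : Idx r n => Idx r n → ℝ) p)

lemma measurable_tip (ξ : Mat r n) : Measurable (fun x : Mat r n => tip ξ x) := by
  simp only [tip_eq_sum]
  exact Finset.measurable_sum _ fun p _ => Finset.measurable_sum _ fun q _ =>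
    (measurable_apply q p).const_mul _

lemma chi_pos (s : Fin (r + 1) → ℝ) {T : Mat r n} (hT : T ∈ Hgrp V) : 0 < chi s T :=
  Finset.prod_pos fun k _ => Real.rpow_pos_of_pos ((mem_Hgrp_iff.1 hT).2 k) _

lemma chi_mul (s : Fin (r + 1) → ℝ) {S T : Mat r n} (hS : S ∈ Hgrp V) (hT : T ∈ Hgrp V) :
    chi s (S * T) = chi s S * chi s T := by
  rw [mem_Hgrp_iff] at hS hT
  rw [chi, chi, chi, ← Finset.prod_mul_distrib]
  refine Finset.prod_congr rfl fun k _ => ?_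
  rw [tdiag_mul hS.1 hT.1, Real.mul_rpow (hS.2 k).le (hT.2 k).le]

lemma integrable_exp_of_laplace {μ : Measure (Mat r n)} {θ : Mat r n}
    (h : laplace μ θ ≠ ⊤) : Integrable (fun x => Real.exp (-tip θ x)) μ := by
  refine ⟨(measurable_tip θ).neg.exp.aestronglyMeasurable, ?_⟩
  rw [hasFiniteIntegral_iff_ofReal (Filter.Eventually.of_forall fun _ => (Real.exp_pos _).le)]
  exact lt_top_iff_ne_top.2 h

lemma laplaceR_eq_toReal (μ : Measure (Mat r n)) (θ : Mat r n) :
    laplaceR μ θ = (laplace μ θ).toReal :=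
  integral_eq_lintegral_of_nonneg_ae (Filter.Eventually.of_forall fun _ => (Real.exp_pos _).le)
    (measurable_tip θ).neg.exp.aestronglyMeasurable

/-- The member `P(θ, μ)` of the natural exponential family generated by `μ`. -/
noncomputable def expFam (μ : Measure (Mat r n)) (θ : Mat r n) : Measure (Mat r n) :=
  μ.tilted fun x => -tip θ x

lemma integral_expFam (μ : Measure (Mat r n)) (θ : Mat r n) (g : Mat r n → ℝ) :
    ∫ x, g x ∂(expFam μ θ) = (laplaceR μ θ)⁻¹ * ∫ x, Real.exp (-tip θ x) * g x ∂μ := by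
  rw [expFam, integral_tilted, ← integral_const_mul]
  refine integral_congr_ae (Filter.Eventually.of_forall fun x => ?_)
  simp only [smul_eq_mul, laplaceR]
  ring

section Family

variable {s : Fin (r + 1) → ℝ} {μ : Measure (Mat r n)} {T : Mat r n}

lemma isProbabilityMeasure_expFam
    (hL : ∀ S ∈ Hgrp V, laplace μ (rhoM S 1) = ENNReal.ofReal (chi (-s) S)) (hT : T ∈ Hgrp V) :
    IsProbabilityMeasure (expFam μ (rhoM T 1)) := by
  have : NeZero μ := ⟨by
    rintro rfl
    have := hL T hT
    rw [laplace, lintegral_zero_measure, eq_comm, ENNReal.ofReal_eq_zero] at this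
    exact this.not_gt (chi_pos _ hT)⟩
  exact isProbabilityMeasure_tilted
    (integrable_exp_of_laplace (hL T hT ▸ ENNReal.ofReal_ne_top))

lemma eventually_cgf_eq (hV1 : CondV1 V) (hV2 : CondV2 V) (hV3 : CondV3 V)
    (hL : ∀ S ∈ Hgrp V, laplace μ (rhoM S 1) = ENNReal.ofReal (chi (-s) S)) (hT : T ∈ Hgrp V)
    {ξ : Mat r n} (hξ : ξ ∈ Zsub V) :
    ∀ᶠ t in nhds (0 : ℝ),
      Integrable (fun x => Real.exp (t * -tip ξ x)) (expFam μ (rhoM T 1)) ∧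
      ProbabilityTheory.cgf (fun x => -tip ξ x) (expFam μ (rhoM T 1)) t =
        logDelta s (rhoM T⁻¹ ξ) t := by
  set B := rhoM T⁻¹ ξ with hB
  have hTu := isUnit_det_of_mem_Hgrp hT
  have hBZ : B ∈ Zsub V := rhoM_mem hV1 hV2 hV3 (mem_Hgrp_iff.1 (inv_mem_Hgrp hV1 hT)).1 hξ
  have hint := integrable_exp_of_laplace (hL T hT ▸ ENNReal.ofReal_ne_top)
  filter_upwards [eventually_posDef (show Bᵀ = B from hBZ.1)] with t ht
  have h1Z : (1 : Mat r n) ∈ Zsub V := by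
    simpa using mul_transpose_self_mem hV2 hV3 (one_mem_lowTri (V := V))
  obtain ⟨S, hS, hSe⟩ := exists_cholesky hV1 hV2 hV3
    (show 1 + t • B ∈ Pcone V from ⟨(Zsub V).add_mem h1Z ((Zsub V).smul_mem t hBZ), ht⟩)
  have hTS := mul_mem_Hgrp hV1 hT hS
  have hθ : rhoM (T * S) 1 = rhoM T 1 + t • ξ := by
    have h2 : rhoM T B = ξ := by rw [hB, rhoM_rhoM, Matrix.mul_nonsing_inv _ hTu, rhoM_one_left]
    have h3 : rhoM T (1 + t • B) = rhoM T 1 + t • rhoM T B := by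
      simp only [rhoM, Matrix.mul_add, Matrix.add_mul, Matrix.mul_smul, Matrix.smul_mul]
    rw [← rhoM_rhoM, ← hSe, h3, h2]
  have hexp : ∀ x, -tip (rhoM T 1) x + t * -tip ξ x = -tip (rhoM (T * S) 1) x := by
    intro x
    rw [hθ, tip_add_left, tip_smul_left]
    ring
  constructor
  · rw [expFam, integrable_tilted_iff hint]
    simp only [smul_eq_mul, ← Real.exp_add, hexp]
    exact integrable_exp_of_laplace (hL _ hTS ▸ ENNReal.ofReal_ne_top)
  · rw [← log_chi_eq hV1 s hS (by rw [hSe, rhoM, Matrix.mul_one]), ProbabilityTheory.cgf,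
      ProbabilityTheory.mgf, expFam, integral_exp_tilted]
    simp only [Pi.add_apply, hexp]
    change Real.log (laplaceR μ (rhoM (T * S) 1) / laplaceR μ (rhoM T 1)) = _
    rw [laplaceR_eq_toReal, laplaceR_eq_toReal, hL _ hTS, hL _ hT,
      ENNReal.toReal_ofReal (chi_pos _ hTS).le, ENNReal.toReal_ofReal (chi_pos _ hT).le,
      chi_mul _ hT hS, mul_div_cancel_left₀ _ (chi_pos _ hT).ne']

lemma zero_mem_interior_integrableExpSet (hV1 : CondV1 V) (hV2 : CondV2 V) (hV3 : CondV3 V)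
    (hL : ∀ S ∈ Hgrp V, laplace μ (rhoM S 1) = ENNReal.ofReal (chi (-s) S)) (hT : T ∈ Hgrp V)
    {ξ : Mat r n} (hξ : ξ ∈ Zsub V) :
    0 ∈ interior (ProbabilityTheory.integrableExpSet (fun x => -tip ξ x)
      (expFam μ (rhoM T 1))) := by
  rw [mem_interior_iff_mem_nhds]
  filter_upwards [eventually_cgf_eq hV1 hV2 hV3 hL hT hξ] with t ht using ht.1

lemma hasJet_cgf (hV1 : CondV1 V) (hV2 : CondV2 V) (hV3 : CondV3 V)
    (hL : ∀ S ∈ Hgrp V, laplace μ (rhoM S 1) = ENNReal.ofReal (chi (-s) S)) (hT : T ∈ Hgrp V)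
    {ξ : Mat r n} (hξ : ξ ∈ Zsub V) :
    HasJet (ProbabilityTheory.cgf (fun x => -tip ξ x) (expFam μ (rhoM T 1)))
      (-∑ p : Idx r n, s p.1 / (n p.1 : ℕ) * rhoM T⁻¹ ξ p p)
      (∑ p : Idx r n, ∑ q : Idx r n,
        s (max p.1 q.1) / (n (max p.1 q.1) : ℕ) * rhoM T⁻¹ ξ p q ^ 2) := by
  refine (hasJet_logDelta s
    (rhoM_mem hV1 hV2 hV3 (mem_Hgrp_iff.1 (inv_mem_Hgrp hV1 hT)).1 hξ).1).congr ?_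
  filter_upwards [eventually_cgf_eq hV1 hV2 hV3 hL hT hξ] with t ht using ht.2

lemma memLp_tip (hV1 : CondV1 V) (hV2 : CondV2 V) (hV3 : CondV3 V)
    (hL : ∀ S ∈ Hgrp V, laplace μ (rhoM S 1) = ENNReal.ofReal (chi (-s) S)) (hT : T ∈ Hgrp V)
    {ξ : Mat r n} (hξ : ξ ∈ Zsub V) : MemLp (fun x => tip ξ x) 2 (expFam μ (rhoM T 1)) := by
  have h := ProbabilityTheory.memLp_of_mem_interior_integrableExpSet
    (zero_mem_interior_integrableExpSet hV1 hV2 hV3 hL hT hξ) 2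
  exact h.neg.ae_eq (Filter.Eventually.of_forall fun x => neg_neg (tip ξ x))

lemma integral_tip (hV1 : CondV1 V) (hV2 : CondV2 V) (hV3 : CondV3 V)
    (hL : ∀ S ∈ Hgrp V, laplace μ (rhoM S 1) = ENNReal.ofReal (chi (-s) S)) (hT : T ∈ Hgrp V)
    {ξ : Mat r n} (hξ : ξ ∈ Zsub V) :
    ∫ x, tip ξ x ∂(expFam μ (rhoM T 1)) =
      ∑ p : Idx r n, s p.1 / (n p.1 : ℕ) * rhoM T⁻¹ ξ p p := by
  have := isProbabilityMeasure_expFam hL hT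
  have h := ProbabilityTheory.deriv_cgf_zero
    (zero_mem_interior_integrableExpSet hV1 hV2 hV3 hL hT hξ)
  rw [(hasJet_cgf hV1 hV2 hV3 hL hT hξ).deriv_eq, integral_neg] at h
  simpa using h.symm

lemma integral_sq_tip (hV1 : CondV1 V) (hV2 : CondV2 V) (hV3 : CondV3 V)
    (hL : ∀ S ∈ Hgrp V, laplace μ (rhoM S 1) = ENNReal.ofReal (chi (-s) S)) (hT : T ∈ Hgrp V)
    {ξ m : Mat r n} (hξ : ξ ∈ Zsub V) (hm : ∫ x, tip ξ x ∂(expFam μ (rhoM T 1)) = tip ξ m) :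
    ∫ x, tip ξ (x - m) ^ 2 ∂(expFam μ (rhoM T 1)) =
      ∑ p : Idx r n, ∑ q : Idx r n,
        s (max p.1 q.1) / (n (max p.1 q.1) : ℕ) * rhoM T⁻¹ ξ p q ^ 2 := by
  have := isProbabilityMeasure_expFam hL hT
  have h := ProbabilityTheory.iteratedDeriv_two_cgf_eq_integral
    (zero_mem_interior_integrableExpSet hV1 hV2 hV3 hL hT hξ)
  rw [(hasJet_cgf hV1 hV2 hV3 hL hT hξ).iteratedDeriv_two_eq,
    (hasJet_cgf hV1 hV2 hV3 hL hT hξ).deriv_eq, ← integral_tip hV1 hV2 hV3 hL hT hξ, hm] at h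
  rw [h]
  simp only [zero_mul, Real.exp_zero, mul_one, ProbabilityTheory.mgf_zero, div_one]
  refine integral_congr_ae (Filter.Eventually.of_forall fun x => ?_)
  simp only [tip_sub_right]
  ring

lemma integral_tip_mul_tip (hV1 : CondV1 V) (hV2 : CondV2 V) (hV3 : CondV3 V)
    (hL : ∀ S ∈ Hgrp V, laplace μ (rhoM S 1) = ENNReal.ofReal (chi (-s) S)) (hT : T ∈ Hgrp V)
    {m : Mat r n} (hm : ∀ ξ ∈ Zsub V, ∫ x, tip ξ x ∂(expFam μ (rhoM T 1)) = tip ξ m)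
    {ξ η : Mat r n} (hξ : ξ ∈ Zsub V) (hη : η ∈ Zsub V) :
    ∫ x, tip ξ (x - m) * tip η (x - m) ∂(expFam μ (rhoM T 1)) =
      ∑ p : Idx r n, ∑ q : Idx r n,
        s (max p.1 q.1) / (n (max p.1 q.1) : ℕ) * (rhoM T⁻¹ ξ p q * rhoM T⁻¹ η p q) := by
  have := isProbabilityMeasure_expFam hL hT
  have hξη := (Zsub V).add_mem hξ hη
  have hint : ∀ ζ ∈ Zsub V, Integrable (fun x => tip ζ (x - m) ^ 2) (expFam μ (rhoM T 1)) := by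
    intro ζ hζ
    have h : MemLp (fun x => tip ζ (x - m)) 2 (expFam μ (rhoM T 1)) := by
      simp only [tip_sub_right]
      exact (memLp_tip hV1 hV2 hV3 hL hT hζ).sub (memLp_const _)
    exact h.integrable_sq
  have hpol : ∀ x, tip ξ (x - m) * tip η (x - m) =
      2⁻¹ * (tip (ξ + η) (x - m) ^ 2 - tip ξ (x - m) ^ 2 - tip η (x - m) ^ 2) := by
    intro x
    rw [tip_add_left]
    ring
  simp only [hpol]
  rw [integral_const_mul, integral_sub
    (show Integrable (fun x => tip (ξ + η) (x - m) ^ 2 - tip ξ (x - m) ^ 2) _ from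
      (hint _ hξη).sub (hint _ hξ)) (hint _ hη),
    integral_sub (hint _ hξη) (hint _ hξ), integral_sq_tip hV1 hV2 hV3 hL hT hξη (hm _ hξη),
    integral_sq_tip hV1 hV2 hV3 hL hT hξ (hm _ hξ), integral_sq_tip hV1 hV2 hV3 hL hT hη (hm _ hη)]
  simp only [← Finset.sum_sub_distrib, Finset.mul_sum]
  refine Finset.sum_congr rfl fun p _ => Finset.sum_congr rfl fun q _ => ?_
  have : rhoM T⁻¹ (ξ + η) p q = rhoM T⁻¹ ξ p q + rhoM T⁻¹ η p q := by
    simp only [rhoM, Matrix.mul_add, Matrix.add_mul, Matrix.add_apply]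
  rw [this]
  ring

end Family


/-! ### The quadratic maps in the variance formula -/

/-- The indicator weight of the blocks with index at most `k`. -/
def lowWeight (u : Fin (r + 1) → ℝ) (k : Fin (r + 1)) : Fin (r + 1) → ℝ :=
  fun l => if l ≤ k then u l else 0

/-- The complementary weight of the blocks with index greater than `k`. -/
def highWeight (u : Fin (r + 1) → ℝ) (k : Fin (r + 1)) : Fin (r + 1) → ℝ :=
  fun l => if l ≤ k then 0 else u l

lemma lead_mul_of_support {k : Fin (r + 1)} {W A : Mat r n}
    (hA : ∀ p q : Idx r n, k < p.1 → A p q = 0) :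
    lead k W * lead k A = lead k (W * A) := by
  ext p q
  have h := Finset.sum_subset (Finset.subset_univ (Finset.univ.filter fun x : Idx r n => x.1 ≤ k))
    (f := fun x => W p.1 x * A x q.1) fun x _ hx => by
      rw [hA x q.1 (not_le.1 fun h => hx (Finset.mem_filter.2 ⟨Finset.mem_univ x, h⟩)), mul_zero]
  rw [Finset.sum_subtype (p := fun x : Idx r n => x.1 ≤ k) _ fun x => by simp] at h
  exact h

lemma pad_lead {k : Fin (r + 1)} {A : Mat r n}
    (hA : ∀ p q : Idx r n, k < p.1 → A p q = 0) (hA' : ∀ p q : Idx r n, k < q.1 → A p q = 0) :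
    pad k (lead k A) = A := by
  ext p q
  simp only [pad, lead, Matrix.of_apply]
  split_ifs with h
  · rfl
  · rw [not_and_or, not_le, not_le] at h
    exact (h.elim (hA p q) (hA' p q)).symm

lemma apply_eq_zero_of_mem_lowTri {T : Mat r n} (hT : T ∈ lowTri V) {p q : Idx r n}
    (h : p.1 < q.1) : T p q = 0 :=
  congrFun (congrFun (hT.1 q.1 p.1 h) p.2) q.2

lemma sub_pad_lead_inv (hV1 : CondV1 V) {T : Mat r n} (hT : T ∈ Hgrp V)
    {u : Fin (r + 1) → ℝ} (hu : ∀ k, u k ≠ 0) (k : Fin (r + 1)) :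
    rhoM (T⁻¹)ᵀ (blockScalar u) - pad k ((lead k (rhoM (T⁻¹)ᵀ (blockScalar u))⁻¹)⁻¹) =
      rhoM (T⁻¹)ᵀ (blockScalar (highWeight u k)) := by
  have hTu := isUnit_det_of_mem_Hgrp hT
  have hTi := (mem_Hgrp_iff.1 (inv_mem_Hgrp hV1 hT)).1
  have hTl := (mem_Hgrp_iff.1 hT).1
  set A : Mat r n := rhoM (T⁻¹)ᵀ (blockScalar (lowWeight u k)) with hA
  have hW : (rhoM (T⁻¹)ᵀ (blockScalar u))⁻¹ = T * blockScalar (fun l => (u l)⁻¹) * Tᵀ := by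
    refine Matrix.inv_eq_left_inv ?_
    calc T * blockScalar (fun l => (u l)⁻¹) * Tᵀ * rhoM (T⁻¹)ᵀ (blockScalar u)
        = T * blockScalar (fun l => (u l)⁻¹) * ((T⁻¹ * T)ᵀ * blockScalar u) * T⁻¹ := by
          simp only [rhoM, Matrix.transpose_mul, Matrix.transpose_transpose, Matrix.mul_assoc]
      _ = 1 := by
          rw [Matrix.nonsing_inv_mul _ hTu, Matrix.transpose_one, Matrix.one_mul,
            Matrix.mul_assoc T, blockScalar_mul]
          simp only [inv_mul_cancel₀ (hu _), blockScalar_one, Matrix.mul_one]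
          exact Matrix.mul_nonsing_inv _ hTu
  have hWA : (rhoM (T⁻¹)ᵀ (blockScalar u))⁻¹ * A =
      T * blockScalar (lowWeight (fun _ => 1) k) * T⁻¹ := by
    rw [hW]
    calc T * blockScalar (fun l => (u l)⁻¹) * Tᵀ * A
        = T * blockScalar (fun l => (u l)⁻¹) *
            ((T⁻¹ * T)ᵀ * blockScalar (lowWeight u k)) * T⁻¹ := by
          simp only [hA, rhoM, Matrix.transpose_mul, Matrix.transpose_transpose, Matrix.mul_assoc]
      _ = _ := by
          rw [Matrix.nonsing_inv_mul _ hTu, Matrix.transpose_one, Matrix.one_mul,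
            Matrix.mul_assoc T, blockScalar_mul]
          congr 3
          funext l
          simp only [lowWeight]
          split_ifs
          · exact inv_mul_cancel₀ (hu l)
          · exact mul_zero _
  have hAapp : ∀ p q, A p q = ∑ x : Idx r n, T⁻¹ x p * (lowWeight u k x.1 * T⁻¹ x q) := by
    intro p q
    simp only [hA, rhoM, Matrix.transpose_transpose, Matrix.mul_assoc, blockScalar]
    rw [Matrix.mul_apply]
    simp only [Matrix.diagonal_mul, Matrix.transpose_apply]
  have hA1 : ∀ p q : Idx r n, k < p.1 → A p q = 0 := by
    intro p q h
    rw [hAapp]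
    refine Finset.sum_eq_zero fun x _ => ?_
    by_cases hx : x.1 ≤ k
    · rw [apply_eq_zero_of_mem_lowTri hTi (hx.trans_lt h), zero_mul]
    · rw [lowWeight, if_neg hx, zero_mul, mul_zero]
  have hA2 : ∀ p q : Idx r n, k < q.1 → A p q = 0 := by
    intro p q h
    rw [hAapp]
    refine Finset.sum_eq_zero fun x _ => ?_
    by_cases hx : x.1 ≤ k
    · rw [apply_eq_zero_of_mem_lowTri hTi (hx.trans_lt h), mul_zero, mul_zero]
    · rw [lowWeight, if_neg hx, zero_mul, mul_zero]
  have hlead : lead k (T * blockScalar (lowWeight (fun _ => 1) k) * T⁻¹ : Mat r n) = 1 := by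
    have h1 : ∀ p q : Idx r n, p.1 ≤ k →
        (T * blockScalar (lowWeight (fun _ => 1) k) * T⁻¹ : Mat r n) p q = (T * T⁻¹) p q := by
      intro p q hp
      rw [Matrix.mul_apply, Matrix.mul_apply]
      refine Finset.sum_congr rfl fun x _ => ?_
      rw [blockScalar, Matrix.mul_diagonal, lowWeight]
      split_ifs with hx
      · rw [mul_one]
      · rw [apply_eq_zero_of_mem_lowTri hTl (hp.trans_lt (not_le.1 hx)), zero_mul]
    ext p q
    rw [lead, Matrix.of_apply, h1 _ _ p.2, Matrix.mul_nonsing_inv _ hTu]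
    simp [Matrix.one_apply, Subtype.ext_iff]
  have hinv : (lead k (rhoM (T⁻¹)ᵀ (blockScalar u))⁻¹)⁻¹ = lead k A := by
    refine Matrix.inv_eq_right_inv ?_
    rw [lead_mul_of_support hA1, hWA, hlead]
  rw [hinv, pad_lead hA1 hA2, hA]
  simp only [rhoM]
  rw [← Matrix.sub_mul, ← Matrix.mul_sub]
  congr 2
  rw [blockScalar, blockScalar, Matrix.diagonal_sub, blockScalar]
  congr 1
  funext p
  simp only [lowWeight, highWeight]
  split_ifs
  · exact sub_self _
  · exact sub_zero _

lemma tip_rhoM_rhoM_blockScalar {S ξ η : Mat r n} (hη : ηᵀ = η) (b : Fin (r + 1) → ℝ) :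
    tip (rhoM (rhoM Sᵀ (blockScalar b)) ξ) η =
      ∑ p : Idx r n, ∑ q : Idx r n, b p.1 * b q.1 * (rhoM S ξ p q * rhoM S η p q) := by
  have h1 : tip (rhoM (rhoM Sᵀ (blockScalar b)) ξ) η =
      (blockScalar b * rhoM S ξ * blockScalar b * (rhoM S η)ᵀ).trace := by
    have : (rhoM S η)ᵀ = rhoM S η := by
      simp only [rhoM, Matrix.transpose_mul, Matrix.transpose_transpose, hη, Matrix.mul_assoc]
    rw [this]
    calc tip (rhoM (rhoM Sᵀ (blockScalar b)) ξ) η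
        = (Sᵀ * (blockScalar b * (S * ξ * Sᵀ) * blockScalar b * S * η)).trace := by
          simp only [tip, rhoM, Matrix.transpose_mul, Matrix.transpose_transpose,
            blockScalar_transpose, Matrix.mul_assoc]
      _ = _ := by
          rw [Matrix.trace_mul_comm]
          simp only [rhoM, Matrix.mul_assoc]
  rw [h1, trace_mul_transpose]
  refine Finset.sum_congr rfl fun p _ => Finset.sum_congr rfl fun q _ => ?_
  rw [blockScalar, Matrix.mul_diagonal, Matrix.diagonal_mul]
  ring

lemma sum_sub_filter_castSucc (g : Fin (r + 1) → ℝ) (m : Fin (r + 1)) :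
    g 0 + ∑ j : Fin r, (g j.succ - g j.castSucc) * (if m ≤ j.castSucc then 0 else 1) = g m := by
  induction m using Fin.induction with
  | zero => simp
  | succ i ih =>
    have h : ∑ j : Fin r, (g j.succ - g j.castSucc) * (if i.succ ≤ j.castSucc then 0 else 1) =
        ∑ j : Fin r, ((g j.succ - g j.castSucc) * (if i.castSucc ≤ j.castSucc then 0 else 1) +
          if j = i then g i.succ - g i.castSucc else 0) := by
      refine Finset.sum_congr rfl fun j _ => ?_
      have h1 : i.succ ≤ j.castSucc ↔ i < j := by
        rw [Fin.le_def, Fin.lt_def, Fin.val_succ, Fin.val_castSucc, Nat.succ_le_iff]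
      have h2 : i.castSucc ≤ j.castSucc ↔ i ≤ j := Fin.castSucc_le_castSucc_iff
      simp only [h1, h2]
      rcases lt_trichotomy j i with h | rfl | h
      · rw [if_neg h.not_gt, if_neg h.not_ge, if_neg h.ne, add_zero]
      · simp
      · rw [if_pos h, if_pos h.le, if_neg h.ne', add_zero]
    rw [h, Finset.sum_add_distrib, Finset.sum_ite_eq' Finset.univ i, if_pos (Finset.mem_univ _),
      ← add_assoc, ih]
    ring

lemma weight_identity {u : Fin (r + 1) → ℝ} (hu : ∀ k, u k ≠ 0) (k l : Fin (r + 1)) :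
    (u 0)⁻¹ * (u k * u l) + ∑ j : Fin r, ((u j.succ)⁻¹ - (u j.castSucc)⁻¹) *
      (highWeight u j.castSucc k * highWeight u j.castSucc l) = u (max k l) := by
  have h := sum_sub_filter_castSucc (fun k => (u k)⁻¹) (min k l)
  have h2 : (u (min k l))⁻¹ * (u k * u l) = u (max k l) := by
    rcases le_total k l with h | h
    · rw [min_eq_left h, max_eq_right h, inv_mul_cancel_left₀ (hu k)]
    · rw [min_eq_right h, max_eq_left h, mul_comm (u k), inv_mul_cancel_left₀ (hu l)]
  rw [← h2, ← h, add_mul, Finset.sum_mul]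
  congr 1
  refine Finset.sum_congr rfl fun j _ => ?_
  simp only [highWeight, min_le_iff]
  by_cases hk : k ≤ j.castSucc
  · simp only [hk, true_or, if_true, zero_mul, mul_zero]
  · by_cases hl : l ≤ j.castSucc
    · simp only [hl, or_true, if_true, zero_mul, mul_zero]
    · simp only [hk, hl, or_self, if_false, mul_one]

lemma sum_weight_identity {u : Fin (r + 1) → ℝ} (hu : ∀ k, u k ≠ 0) (F : Idx r n → Idx r n → ℝ) :
    ∑ a : Idx r n, ∑ b : Idx r n, u (max a.1 b.1) * F a b =
      (u 0)⁻¹ * ∑ a : Idx r n, ∑ b : Idx r n, u a.1 * u b.1 * F a b +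
        ∑ j : Fin r, ((u j.succ)⁻¹ - (u j.castSucc)⁻¹) * ∑ a : Idx r n, ∑ b : Idx r n,
          highWeight u j.castSucc a.1 * highWeight u j.castSucc b.1 * F a b := by
  simp only [Finset.mul_sum]
  rw [Finset.sum_comm (s := (Finset.univ : Finset (Fin r))), ← Finset.sum_add_distrib]
  refine Finset.sum_congr rfl fun a _ => ?_
  rw [Finset.sum_comm (s := (Finset.univ : Finset (Fin r))), ← Finset.sum_add_distrib]
  refine Finset.sum_congr rfl fun b _ => ?_
  rw [← weight_identity hu, add_mul, Finset.sum_mul]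
  simp only [mul_assoc]

/-! ### The mean and the covariance operator -/

lemma ae_mem_Zspace_expFam {μ : Measure (Mat r n)} (hμsupp : μ (Zspace V)ᶜ = 0) (θ : Mat r n) :
    ∀ᵐ x ∂(expFam μ θ), x ∈ Zspace V :=
  (tilted_absolutelyContinuous μ _).ae_le (mem_ae_iff.2 hμsupp)

lemma eq_of_forall_tip_eq {x y : Mat r n} (hx : x ∈ Zsub V) (hy : y ∈ Zsub V)
    (h : ∀ a ∈ Zspace V, tip x a = tip y a) : x = y := by
  have hd := (Zsub V).sub_mem hx hy
  have h0 : ((x - y) * (x - y)ᵀ).trace = 0 := by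
    rw [show (x - y)ᵀ = x - y from hd.1, Matrix.sub_mul, Matrix.trace_sub]
    exact sub_eq_zero.2 (h _ hd)
  rw [trace_mul_transpose] at h0
  rw [← sub_eq_zero]
  ext p q
  have h1 := (Finset.sum_eq_zero_iff_of_nonneg fun p _ => Finset.sum_nonneg fun q _ =>
    mul_self_nonneg ((x - y) p q)).1 h0 p (Finset.mem_univ p)
  exact mul_self_eq_zero.1 ((Finset.sum_eq_zero_iff_of_nonneg fun q _ =>
    mul_self_nonneg ((x - y) p q)).1 h1 q (Finset.mem_univ q))

lemma one_mem_Zsub (hV2 : CondV2 V) (hV3 : CondV3 V) : (1 : Mat r n) ∈ Zsub V := by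
  simpa using mul_transpose_self_mem hV2 hV3 (one_mem_lowTri (V := V))

section Family

variable {s : Fin (r + 1) → ℝ} {μ : Measure (Mat r n)} {T : Mat r n} {piL : Mat r n → Mat r n}

lemma apply_eq_tip_proj (hpi : ∀ x : Mat r n, piL x ∈ Zspace V ∧
      ∀ a ∈ Zspace V, tip (piL x) a = tip x a)
    {x : Mat r n} (hx : x ∈ Zspace V) (p q : Idx r n) :
    x p q = tip (piL (Matrix.single q p 1)) x :=
  (((hpi _).2 x hx).trans (tip_single_left p q x)).symm

lemma integral_tip_eq_tip_meanMap (hV1 : CondV1 V) (hV2 : CondV2 V) (hV3 : CondV3 V)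
    (hL : ∀ S ∈ Hgrp V, laplace μ (rhoM S 1) = ENNReal.ofReal (chi (-s) S)) (hT : T ∈ Hgrp V)
    (hμsupp : μ (Zspace V)ᶜ = 0)
    (hpi : ∀ x : Mat r n, piL x ∈ Zspace V ∧ ∀ a ∈ Zspace V, tip (piL x) a = tip x a)
    (ξ : Mat r n) :
    ∫ x, tip ξ x ∂(expFam μ (rhoM T 1)) = tip ξ (meanMap μ (rhoM T 1)) := by
  have := isProbabilityMeasure_expFam hL hT
  have hint : ∀ p q, Integrable (fun x : Mat r n => x p q) (expFam μ (rhoM T 1)) := by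
    intro p q
    refine ((memLp_tip hV1 hV2 hV3 hL hT (hpi (Matrix.single q p 1)).1).integrable
      (by norm_num)).congr ?_
    filter_upwards [ae_mem_Zspace_expFam hμsupp (rhoM T 1)] with x hx
    exact (apply_eq_tip_proj hpi hx p q).symm
  have hmean : ∀ p q, ∫ x, x p q ∂(expFam μ (rhoM T 1)) = meanMap μ (rhoM T 1) p q :=
    fun p q => integral_expFam _ _ _
  simp only [tip_eq_sum]
  refine (integral_finsetSum _ fun p _ => integrable_finsetSum _ fun q _ =>
    (hint q p).const_mul (ξ p q)).trans (Finset.sum_congr rfl fun p _ => ?_)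
  refine (integral_finsetSum _ fun q _ => (hint q p).const_mul (ξ p q)).trans
    (Finset.sum_congr rfl fun q _ => ?_)
  exact (integral_const_mul _ _).trans (congrArg _ (hmean q p))

lemma varOp_apply (hV1 : CondV1 V) (hV2 : CondV2 V) (hV3 : CondV3 V)
    (hL : ∀ S ∈ Hgrp V, laplace μ (rhoM S 1) = ENNReal.ofReal (chi (-s) S)) (hT : T ∈ Hgrp V)
    (hμsupp : μ (Zspace V)ᶜ = 0)
    (hpi : ∀ x : Mat r n, piL x ∈ Zspace V ∧ ∀ a ∈ Zspace V, tip (piL x) a = tip x a)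
    {m ξ : Mat r n} (hm : meanMap μ (rhoM T 1) = m) (hmZ : m ∈ Zspace V) (hξ : ξ ∈ Zspace V)
    (p q : Idx r n) :
    varOp μ (rhoM T 1) m ξ p q =
      ∑ a : Idx r n, ∑ b : Idx r n, s (max a.1 b.1) / (n (max a.1 b.1) : ℕ) *
        (rhoM T⁻¹ ξ a b * rhoM T⁻¹ (piL (Matrix.single q p 1)) a b) := by
  rw [← integral_tip_mul_tip hV1 hV2 hV3 hL hT (m := m) (fun ζ _ => hm ▸
    integral_tip_eq_tip_meanMap hV1 hV2 hV3 hL hT hμsupp hpi ζ) hξ (hpi _).1]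
  have h : ∫ x, tip ξ (x - m) * tip (piL (Matrix.single q p 1)) (x - m) ∂(expFam μ (rhoM T 1)) =
      ∫ x, tip ξ (x - m) * (x - m) p q ∂(expFam μ (rhoM T 1)) := by
    refine integral_congr_ae ?_
    filter_upwards [ae_mem_Zspace_expFam hμsupp (rhoM T 1)] with x hx
    exact congrArg _ (apply_eq_tip_proj hpi ((Zsub V).sub_mem hx hmZ) p q).symm
  rw [h, integral_expFam]
  simp only [← mul_assoc]
  rfl

lemma hat_meanMap (hV1 : CondV1 V) (hV2 : CondV2 V) (hV3 : CondV3 V)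
    (hL : ∀ S ∈ Hgrp V, laplace μ (rhoM S 1) = ENNReal.ofReal (chi (-s) S)) (hT : T ∈ Hgrp V)
    (hμsupp : μ (Zspace V)ᶜ = 0)
    (hpi : ∀ x : Mat r n, piL x ∈ Zspace V ∧ ∀ a ∈ Zspace V, tip (piL x) a = tip x a)
    {rstar : Mat r n → Mat r n → Mat r n}
    (hrstar : ∀ T ∈ Hgrp V, ∀ ξ ∈ Zspace V, rstar T ξ ∈ Zspace V ∧
      ∀ x ∈ Zspace V, tip (rstar T ξ) x = tip ξ (rhoM T x))
    {hat : Mat r n → Mat r n} (hhat : ∀ T ∈ Hgrp V, hat (rstar T 1) = Tᵀ * T)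
    (hspos : ∀ k, 0 < s k) {m : Mat r n} (hm : meanMap μ (rhoM T 1) = m) (hmZ : m ∈ Zspace V) :
    hat m = rhoM (T⁻¹)ᵀ (blockScalar fun k => s k / (n k : ℕ)) := by
  have hn : ∀ k, (0 : ℝ) < (n k : ℕ) := fun k => Nat.cast_pos.2 (n k).pos
  have hu : ∀ k, 0 < s k / (n k : ℕ) := fun k => div_pos (hspos k) (hn k)
  have hS := mul_mem_Hgrp hV1 (blockScalar_mem_Hgrp fun k => Real.sqrt_pos.2 (hu k))
    (inv_mem_Hgrp hV1 hT)
  have h1 := one_mem_Zsub hV2 hV3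
  have hsq : (fun k => √(s k / (n k : ℕ)) * √(s k / (n k : ℕ))) = fun k => s k / (n k : ℕ) :=
    funext fun k => Real.mul_self_sqrt (hu k).le
  have hmr : m = rstar (blockScalar (fun k => √(s k / (n k : ℕ))) * T⁻¹) 1 := by
    refine eq_of_forall_tip_eq hmZ (hrstar _ hS 1 h1).1 fun x hx => ?_
    rw [(hrstar _ hS 1 h1).2 x hx, tip_comm, ← hm,
      ← integral_tip_eq_tip_meanMap hV1 hV2 hV3 hL hT hμsupp hpi x,
      integral_tip hV1 hV2 hV3 hL hT hx, ← rhoM_rhoM, tip, Matrix.one_mul, Matrix.trace]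
    refine Finset.sum_congr rfl fun p _ => ?_
    have h := blockScalar_mul_mul_apply (fun k => √(s k / (n k : ℕ)))
      (fun k => √(s k / (n k : ℕ))) (rhoM T⁻¹ x) p p
    rw [mul_right_comm, Real.mul_self_sqrt (hu _).le] at h
    exact h.symm.trans (congrFun (congrFun (rhoM_blockScalar _ _).symm p) p)
  rw [hmr, hhat _ hS, rhoM, Matrix.transpose_mul, blockScalar_transpose, Matrix.mul_assoc,
    ← Matrix.mul_assoc (blockScalar _), blockScalar_mul, hsq, Matrix.transpose_transpose,
    Matrix.mul_assoc]

end Family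

/-- **main theorem.** Let `s ∈ 𝔛` with all `s_k > 0`, and `R*_s` the Riesz
measure with Laplace transform `Δ_{-s}` on `𝒫`.  Then for every `m ∈ 𝒬 = M_{F(R*_s)}`,
the variance function of `F(R*_s)` is
`V(m) = π ∘ { (n_1/s_1) ρ(m̂) + Σ_{i=2}^{r} (n_i/s_i - n_{i-1}/s_{i-1})
  ρ(m̂ - [((m̂⁻¹)_{1:i-1})⁻¹]₀) }` as a linear operator on `𝒵`. -/
theorem statement12 (r : ℕ) (n : Fin (r + 1) → ℕ+)
    (V : ∀ l k : Fin (r + 1), Submodule ℝ (Matrix (Fin (n l)) (Fin (n k)) ℝ))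
    (hV1 : CondV1 V) (hV2 : CondV2 V) (hV3 : CondV3 V)
    (rstar : Mat r n → Mat r n → Mat r n)
    (hrstar : ∀ T ∈ Hgrp V, ∀ ξ ∈ Zspace V, rstar T ξ ∈ Zspace V ∧
      ∀ x ∈ Zspace V, tip (rstar T ξ) x = tip ξ (rhoM T x))
    (Δf : (Fin (r + 1) → ℝ) → Mat r n → ℝ)
    (hΔ : ∀ s : Fin (r + 1) → ℝ, ∀ T ∈ Hgrp V, Δf s (rhoM T 1) = chi s T)
    (piL : Mat r n → Mat r n)
    (hpi : ∀ x : Mat r n, piL x ∈ Zspace V ∧ ∀ a ∈ Zspace V, tip (piL x) a = tip x a)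
    (hat : Mat r n → Mat r n)
    (hhat : ∀ T ∈ Hgrp V, hat (rstar T 1) = Tᵀ * T)
    (s : Fin (r + 1) → ℝ) (hs : s ∈ frakX V) (hspos : ∀ k, 0 < s k)
    (μ : Measure (Mat r n)) (hμsupp : μ (Zspace V)ᶜ = 0)
    (hμL : ∀ θ ∈ Pcone V, laplace μ θ = ENNReal.ofReal (Δf (-s) θ))
    (ψ : Mat r n → Mat r n)
    (hψ : ∀ m ∈ Qcone V, ψ m ∈ Pcone V ∧ meanMap μ (ψ m) = m) :
    ∀ m ∈ Qcone V, ∀ ξ ∈ Zspace V,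
      varOp μ (ψ m) m ξ
        = piL ((((n 0 : ℕ) : ℝ) / s 0) • rhoM (hat m) ξ
            + ∑ j : Fin r,
                ((((n j.succ : ℕ) : ℝ) / s j.succ - ((n j.castSucc : ℕ) : ℝ) / s j.castSucc))
                  • rhoM (hat m - pad j.castSucc ((lead j.castSucc (hat m)⁻¹)⁻¹)) ξ) := by
  intro m hm ξ hξ
  obtain ⟨hθ, hmean⟩ := hψ m hm
  obtain ⟨T, hT, hθT⟩ := exists_cholesky hV1 hV2 hV3 hθ
  have hL : ∀ S ∈ Hgrp V, laplace μ (rhoM S 1) = ENNReal.ofReal (chi (-s) S) := fun S hS => by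
    rw [hμL _ (rhoM_one_mem_Pcone hV2 hV3 hS), hΔ _ S hS]
  rw [hθT] at hmean ⊢
  have hu : ∀ k, s k / (n k : ℕ) ≠ 0 := fun k =>
    div_ne_zero (hspos k).ne' (Nat.cast_ne_zero.2 (n k).ne_zero)
  rw [hat_meanMap hV1 hV2 hV3 hL hT hμsupp hpi hrstar hhat hspos hmean hm.1]
  simp only [sub_pad_lead_inv hV1 hT hu]
  ext p q
  have hη := (hpi (Matrix.single q p 1)).1
  refine (varOp_apply hV1 hV2 hV3 hL hT hμsupp hpi hmean hm.1 hξ p q).trans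
    (Eq.trans ?_ (apply_eq_tip_proj hpi (hpi _).1 p q).symm)
  rw [tip_comm, (hpi _).2 _ hη, tip_add_left, tip_sum_left, tip_smul_left]
  simp only [tip_smul_left, tip_rhoM_rhoM_blockScalar (show _ = _ from hη.1)]
  have h := sum_weight_identity hu fun a b =>
    rhoM T⁻¹ ξ a b * rhoM T⁻¹ (piL (Matrix.single q p 1)) a b
  simp only [inv_div] at h
  exact h

end Wishart
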